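/- arXiv:math/0107081 — 3 statements merged into one kernel-verified Lean document; each statement's English description precedes it below -/
import Mathlib

section
/- Let γ be a monotonicity-preserving specification. Then the weak limits μ± = lim_{Λ↑𝕃} γ_Λ(·|±) exist and define two extremal measures with μ⁺ ∈ 𝒢(γ^(+)) and μ⁻ ∈ 𝒢(γ^(−)) (so μ⁺ is right continuous and μ⁻ left continuous); they are translation invariant if γ is; and for every increasing local f and every μ ∈ 𝒢(γ): μ⁻(f) ≤ μ(f) ≤ μ⁺(f). -/
open MeasureTheory Filter Topology
open scoped ENNReal MeasureTheory Classical

noncomputable section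

/-- The σ-algebra on configuration space generated by the coordinates in `Δ`. -/
def cylinderSigma (Ω₀ : Type*) [MeasurableSpace Ω₀] {ι : Type*} (Δ : Set ι) :
    MeasurableSpace (ι → Ω₀) :=
  MeasurableSpace.comap (fun ω (x : Δ) => ω (x : ι)) MeasurableSpace.pi

/-- The configuration agreeing with `ω` on `S` and with `θ` off `S`. -/
def splice {ι Ω₀ : Type*} (S : Set ι) (ω θ : ι → Ω₀) : ι → Ω₀ :=
  fun x => if x ∈ S then ω x else θ x

/-- A function is local if it is measurable with respect to a finite cylinder σ-algebra. -/
def IsLocal {ι Ω₀ : Type*} [MeasurableSpace Ω₀] (f : (ι → Ω₀) → ℝ) : Prop :=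
  ∃ Δ : Finset ι, Measurable[cylinderSigma Ω₀ (Δ : Set ι)] f

/-- Quasilocality of `f` in the direction `θ`. -/
def QuasilocalInDir {ι Ω₀ : Type*} (θ : ι → Ω₀) (f : (ι → Ω₀) → ℝ) : Prop :=
  ∀ ω, Tendsto (fun S : Finset ι => f (splice (S : Set ι) ω θ)) atTop (𝓝 (f ω))

/-- `f` is quasilocal: a uniform limit of local functions. -/
def IsQuasilocal {ι Ω₀ : Type*} [MeasurableSpace Ω₀] (f : (ι → Ω₀) → ℝ) : Prop :=
  ∀ ε : ℝ, 0 < ε → ∃ g, IsLocal g ∧ ∀ ω, |f ω - g ω| ≤ ε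

/-- A specification: a proper consistent family of probability kernels indexed by
finite subsets of the site space. -/
structure Specification (ι Ω₀ : Type*) [MeasurableSpace Ω₀] where
  k : Finset ι → (ι → Ω₀) → Measure (ι → Ω₀)
  isProb : ∀ Λ ω, IsProbabilityMeasure (k Λ ω)
  meas : ∀ (Λ : Finset ι) (A : Set (ι → Ω₀)), MeasurableSet A →
    Measurable[cylinderSigma Ω₀ ((Λ : Set ι))ᶜ] (fun ω => k Λ ω A)
  proper : ∀ (Λ : Finset ι) (B : Set (ι → Ω₀)),
    MeasurableSet[cylinderSigma Ω₀ ((Λ : Set ι))ᶜ] B → ∀ ω, k Λ ω B = B.indicator 1 ω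
  consistent : ∀ ⦃Λ Λ' : Finset ι⦄, Λ ⊆ Λ' → ∀ ω, (k Λ' ω).bind (k Λ) = k Λ' ω

/-- `γ_Λ f`, the expectation of `f` under the kernel of the specification. -/
def specInt {ι Ω₀ : Type*} [MeasurableSpace Ω₀] (γ : Specification ι Ω₀)
    (Λ : Finset ι) (f : (ι → Ω₀) → ℝ) (ω : ι → Ω₀) : ℝ :=
  ∫ x, f x ∂(γ.k Λ ω)

/-- DLR consistency of a measure with a specification. -/
def IsGibbs {ι Ω₀ : Type*} [MeasurableSpace Ω₀] (γ : Specification ι Ω₀)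
    (μ : Measure (ι → Ω₀)) : Prop :=
  ∀ Λ, μ.bind (γ.k Λ) = μ

/-- A specification is quasilocal in the direction `θ`. -/
def SpecQuasilocalInDir {ι Ω₀ : Type*} [MeasurableSpace Ω₀] (γ : Specification ι Ω₀)
    (θ : ι → Ω₀) : Prop :=
  ∀ Λ f, IsLocal f → QuasilocalInDir θ (specInt γ Λ f)

/-- A quasilocal specification. -/
def IsSpecQuasilocal {ι Ω₀ : Type*} [MeasurableSpace Ω₀] (γ : Specification ι Ω₀) : Prop :=
  ∀ Λ f, IsLocal f → IsQuasilocal (specInt γ Λ f)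

/-- A monotonicity-preserving specification. -/
def MonoPreserving {ι Ω₀ : Type*} [MeasurableSpace Ω₀] [Preorder Ω₀]
    (γ : Specification ι Ω₀) : Prop :=
  ∀ Λ (f : (ι → Ω₀) → ℝ), Measurable f → Monotone f → Monotone (specInt γ Λ f)

/-- `γ'` is the limit of `γ` with boundary condition forced to `θ` outside larger
and larger volumes. -/
def IsDirLimitSpec {ι Ω₀ : Type*} [MeasurableSpace Ω₀] (γ γ' : Specification ι Ω₀)
    (θ : ι → Ω₀) : Prop :=
  ∀ Λ f, IsLocal f → ∀ ω,
    Tendsto (fun S : Finset ι => specInt γ Λ f (splice (S : Set ι) ω θ)) atTop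
      (𝓝 (specInt γ' Λ f ω))

/-- `μ` is the weak limit `lim_{Λ↑𝕃} γ_Λ(⬝|θ)`. -/
def IsLimitWithBoundary {ι Ω₀ : Type*} [MeasurableSpace Ω₀] (γ : Specification ι Ω₀)
    (θ : ι → Ω₀) (μ : Measure (ι → Ω₀)) : Prop :=
  IsProbabilityMeasure μ ∧
    ∀ f, IsLocal f → Tendsto (fun Λ : Finset ι => specInt γ Λ f θ) atTop (𝓝 (∫ ω, f ω ∂μ))

/-- The set of configurations at which all the `γ_Λ f` (`f` local) are continuous. -/
def contSet {ι Ω₀ : Type*} [MeasurableSpace Ω₀] [TopologicalSpace Ω₀]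
    (γ : Specification ι Ω₀) : Set (ι → Ω₀) :=
  {ω | ∀ Λ f, IsLocal f → ContinuousAt (specInt γ Λ f) ω}

/-- An almost quasilocal probability measure. -/
def AlmostQuasilocal {ι Ω₀ : Type*} [MeasurableSpace Ω₀] [TopologicalSpace Ω₀]
    (μ : Measure (ι → Ω₀)) : Prop :=
  ∃ γ : Specification ι Ω₀, IsGibbs γ μ ∧ μ (contSet γ) = 1

/-- Sites of the lattice `ℤ^d`. -/
abbrev Site (d : ℕ) := Fin d → ℤ

/-- The cube `Λ_n = ([-n,n] ∩ ℤ)^d`. -/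
def cube (d : ℕ) (n : ℕ) : Finset (Site d) :=
  Fintype.piFinset fun _ => Finset.Icc (-(n : ℤ)) (n : ℤ)

/-- Translation of a configuration by `i`. -/
def shift {Ω₀ : Type*} {d : ℕ} (i : Site d) (ω : Site d → Ω₀) : Site d → Ω₀ :=
  fun x => ω (x - i)

/-- Translation invariance of a measure. -/
def TransInv {Ω₀ : Type*} [MeasurableSpace Ω₀] {d : ℕ} (μ : Measure (Site d → Ω₀)) : Prop :=
  ∀ i : Site d, μ.map (shift i) = μ

/-- Translation invariance of a specification. -/
def TransInvSpec {Ω₀ : Type*} [MeasurableSpace Ω₀] {d : ℕ}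
    (γ : Specification (Site d) Ω₀) : Prop :=
  ∀ (i : Site d) (Λ : Finset (Site d)) (ω),
    γ.k (Λ.image (· + i)) (shift i ω) = (γ.k Λ ω).map (shift i)

/-- Restriction (projection) of a measure to the coordinates in `Δ`. -/
def restrictTo {ι Ω₀ : Type*} [MeasurableSpace Ω₀] (Δ : Finset ι)
    (μ : Measure (ι → Ω₀)) : Measure ({x // x ∈ Δ} → Ω₀) :=
  μ.map (fun ω (x : {x // x ∈ Δ}) => ω (x : ι))

/-- The Radon–Nikodym density `dμ_Δ/dν_Δ`, viewed as a function on configuration space. -/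
def density {ι Ω₀ : Type*} [MeasurableSpace Ω₀] (Δ : Finset ι)
    (μ ν : Measure (ι → Ω₀)) : (ι → Ω₀) → ℝ :=
  fun ω => ((restrictTo Δ μ).rnDeriv (restrictTo Δ ν) (fun x : {x // x ∈ Δ} => ω (x : ι))).toReal

/-- Relative entropy `H_Δ(μ|ν)` at the finite volume `Δ` (`+∞` if `μ_Δ` is not
absolutely continuous with respect to `ν_Δ`). -/
def relEnt {ι Ω₀ : Type*} [MeasurableSpace Ω₀] (Δ : Finset ι)
    (μ ν : Measure (ι → Ω₀)) : ℝ≥0∞ :=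
  if restrictTo Δ μ ≪ restrictTo Δ ν then
    ENNReal.ofReal (∫ ω, density Δ μ ν ω * Real.log (density Δ μ ν ω) ∂ν)
  else ⊤

/-- Vanishing relative entropy density: `h(μ|ν) = 0`. -/
def EntDensityZero {Ω₀ : Type*} [MeasurableSpace Ω₀] {d : ℕ}
    (μ ν : Measure (Site d → Ω₀)) : Prop :=
  Tendsto (fun n => relEnt (cube d n) μ ν / ((cube d n).card : ℝ≥0∞)) atTop (𝓝 0)


/-- `μ` is an extreme point of the set of probability measures consistent with `γ`. -/
def IsExtremeIn {ι Ω₀ : Type*} [MeasurableSpace Ω₀] (γ : Specification ι Ω₀)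
    (μ : Measure (ι → Ω₀)) : Prop :=
  ∀ μ₁ μ₂ : Measure (ι → Ω₀), IsProbabilityMeasure μ₁ → IsProbabilityMeasure μ₂ →
    IsGibbs γ μ₁ → IsGibbs γ μ₂ → ∀ t : ℝ≥0∞, 0 < t → t < 1 →
      μ = t • μ₁ + (1 - t) • μ₂ → μ₁ = μ₂

section Helpers

variable {ι Ω₀ : Type*} [MeasurableSpace Ω₀]

theorem cylinderSigma_le (Δ : Set ι) :
    cylinderSigma Ω₀ Δ ≤ (MeasurableSpace.pi : MeasurableSpace (ι → Ω₀)) := by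
  unfold cylinderSigma
  exact Measurable.comap_le (measurable_pi_lambda _ fun x => measurable_pi_apply _)

theorem IsLocal.meas {f : (ι → Ω₀) → ℝ} (hf : IsLocal f) : Measurable f := by
  obtain ⟨Δ, h⟩ := hf
  exact h.mono (cylinderSigma_le _) le_rfl

theorem IsLocal.dep {f : (ι → Ω₀) → ℝ} (hf : IsLocal f) :
    ∃ Δ : Finset ι, ∀ ω ω' : ι → Ω₀, (∀ x ∈ Δ, ω x = ω' x) → f ω = f ω' := by
  obtain ⟨Δ, h⟩ := hf
  refine ⟨Δ, fun ω ω' hx => ?_⟩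
  obtain ⟨s, -, hs⟩ := h (measurableSet_singleton (f ω))
  have h1 : ω ∈ f ⁻¹' {f ω} := rfl
  have h2 : ω' ∈ f ⁻¹' {f ω} := by
    rw [← hs] at h1 ⊢
    have : (fun (x : (Δ : Set ι)) => ω' (x : ι)) = (fun (x : (Δ : Set ι)) => ω (x : ι)) := by
      funext x; exact (hx x x.2).symm
    simp only [Set.mem_preimage] at h1 ⊢
    rwa [this]
  exact h2.symm

theorem dep_factor {f : (ι → Ω₀) → ℝ} (θ : ι → Ω₀) {Δ : Finset ι}
    (h : ∀ ω ω' : ι → Ω₀, (∀ x ∈ Δ, ω x = ω' x) → f ω = f ω') :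
    ∃ g : (↥(Δ : Set ι) → Ω₀) → ℝ, f = fun ω => g (fun x => ω (x : ι)) := by
  refine ⟨fun η => f (fun x => if hx : x ∈ (Δ : Set ι) then η ⟨x, hx⟩ else θ x), ?_⟩
  funext ω
  refine h _ _ fun x hx => ?_
  have : x ∈ (Δ : Set ι) := hx
  simp [hx]

theorem isLocal_of_dep [Fintype Ω₀] [DiscreteMeasurableSpace Ω₀] {f : (ι → Ω₀) → ℝ}
    (θ : ι → Ω₀) (Δ : Finset ι)
    (h : ∀ ω ω' : ι → Ω₀, (∀ x ∈ Δ, ω x = ω' x) → f ω = f ω') : IsLocal f := by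
  obtain ⟨g, hg⟩ := dep_factor θ h
  refine ⟨Δ, ?_⟩
  rw [hg]
  have hgm : Measurable g := by
    have : MeasurableSingletonClass (↥(Δ : Set ι) → Ω₀) := inferInstance
    exact measurable_of_finite g
  intro s hs
  exact ⟨g ⁻¹' s, hgm hs, rfl⟩

theorem IsLocal.bdd [Fintype Ω₀] {f : (ι → Ω₀) → ℝ} (hf : IsLocal f) :
    ∃ C, ∀ ω, |f ω| ≤ C := by
  by_cases hne : Nonempty (ι → Ω₀)
  · obtain ⟨θ⟩ := hne
    obtain ⟨Δ, h⟩ := hf.dep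
    obtain ⟨g, hg⟩ := dep_factor θ h
    obtain ⟨C, hC⟩ := (Set.finite_range (fun η => |g η|)).bddAbove
    exact ⟨C, fun ω => hg ▸ hC ⟨_, rfl⟩⟩
  · exact ⟨0, fun ω => (hne ⟨ω⟩).elim⟩

theorem integrable_of_meas_bdd {f : (ι → Ω₀) → ℝ} (hf : Measurable f) {C : ℝ}
    (hC : ∀ ω, |f ω| ≤ C) (μ : Measure (ι → Ω₀)) [IsFiniteMeasure μ] : Integrable f μ :=
  Integrable.of_bound hf.aestronglyMeasurable C (Filter.Eventually.of_forall hC)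

theorem IsLocal.integ [Fintype Ω₀] {f : (ι → Ω₀) → ℝ} (hf : IsLocal f)
    (μ : Measure (ι → Ω₀)) [IsFiniteMeasure μ] : Integrable f μ := by
  obtain ⟨C, hC⟩ := hf.bdd
  exact integrable_of_meas_bdd hf.meas hC μ

theorem Specification.kmeas (γ : Specification ι Ω₀) (Λ : Finset ι) : Measurable (γ.k Λ) :=
  Measure.measurable_of_measurable_coe _ fun s hs =>
    (γ.meas Λ s hs).mono (cylinderSigma_le _) le_rfl

theorem specInt_meas (γ : Specification ι Ω₀) (Λ : Finset ι) {f : (ι → Ω₀) → ℝ}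
    (hf : Measurable f) : Measurable (specInt γ Λ f) := by
  let κ : ProbabilityTheory.Kernel (ι → Ω₀) (ι → Ω₀) := ⟨γ.k Λ, γ.kmeas Λ⟩
  have : ProbabilityTheory.IsMarkovKernel κ := ⟨fun ω => γ.isProb Λ ω⟩
  have := (hf.stronglyMeasurable.integral_kernel (κ := κ)).measurable
  exact this

theorem specInt_bdd (γ : Specification ι Ω₀) (Λ : Finset ι) {f : (ι → Ω₀) → ℝ}
    {C : ℝ} (hC : ∀ ω, |f ω| ≤ C) (ω) : |specInt γ Λ f ω| ≤ C := by
  have := γ.isProb Λ ω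
  have := norm_integral_le_of_norm_le_const (μ := γ.k Λ ω) (f := f) (Filter.Eventually.of_forall hC)
  simpa [specInt] using this

theorem integral_bind_spec (γ : Specification ι Ω₀) (Λ : Finset ι) {f : (ι → Ω₀) → ℝ}
    (hf : Measurable f) {C : ℝ} (hC : ∀ ω, |f ω| ≤ C) (μ : Measure (ι → Ω₀))
    [IsProbabilityMeasure μ] :
    ∫ ω, f ω ∂(μ.bind (γ.k Λ)) = ∫ ω, specInt γ Λ f ω ∂μ := by
  let κ : ProbabilityTheory.Kernel (ι → Ω₀) (ι → Ω₀) := ⟨γ.k Λ, γ.kmeas Λ⟩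
  have : ProbabilityTheory.IsMarkovKernel κ := ⟨fun ω => γ.isProb Λ ω⟩
  have h := ProbabilityTheory.Kernel.integral_comp (a := ())
    (κ := ProbabilityTheory.Kernel.const Unit μ) (η := κ) (f := f)
    (integrable_of_meas_bdd hf hC _)
  rw [ProbabilityTheory.Kernel.comp_apply] at h
  exact h

theorem isProb_bind (γ : Specification ι Ω₀) (Λ : Finset ι) (μ : Measure (ι → Ω₀))
    [IsProbabilityMeasure μ] : IsProbabilityMeasure (μ.bind (γ.k Λ)) := by
  constructor
  rw [Measure.bind_apply MeasurableSet.univ (γ.kmeas Λ).aemeasurable]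
  have : ∀ ω, γ.k Λ ω Set.univ = 1 := fun ω => (γ.isProb Λ ω).measure_univ
  simp [this]

theorem measure_ext_local [Fintype Ω₀] [DiscreteMeasurableSpace Ω₀]
    (θ : ι → Ω₀) {μ ν : Measure (ι → Ω₀)} [IsProbabilityMeasure μ]
    [IsProbabilityMeasure ν] (h : ∀ f, IsLocal f → ∫ ω, f ω ∂μ = ∫ ω, f ω ∂ν) : μ = ν := by
  refine ext_of_generate_finite (measurableCylinders fun _ : ι => Ω₀)
    generateFrom_measurableCylinders.symm isPiSystem_measurableCylinders ?_ (by simp)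
  intro s hs
  have hsm : MeasurableSet s := MeasurableSet.of_mem_measurableCylinders hs
  rw [mem_measurableCylinders] at hs
  obtain ⟨Δ, S, hS, rfl⟩ := hs
  have := h ((cylinder Δ S).indicator 1) (isLocal_of_dep θ Δ fun ω ω' hx => by
    have : Δ.restrict ω = Δ.restrict ω' := by
      funext x; exact hx x x.2
    simp only [Set.indicator, mem_cylinder, this, Pi.one_apply])
  rw [integral_indicator_one hsm, integral_indicator_one hsm] at this
  exact (measureReal_eq_measureReal_iff).1 this

theorem local_decomp [Fintype Ω₀] [DiscreteMeasurableSpace Ω₀] [PartialOrder Ω₀]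
    (θ : ι → Ω₀) {f : (ι → Ω₀) → ℝ} (hf : IsLocal f) :
    ∃ g h, IsLocal g ∧ Monotone g ∧ IsLocal h ∧ Monotone h ∧ ∀ ω, f ω = g ω - h ω := by
  obtain ⟨Δ, hΔ⟩ := hf.dep
  obtain ⟨C, hC⟩ := hf.bdd
  have hC0 : 0 ≤ C := (abs_nonneg _).trans (hC θ)
  let r : Ω₀ → ℝ := fun a => ((Finset.univ.filter (· < a)).card : ℝ)
  have hr : ∀ a b, a < b → r a + 1 ≤ r b := by
    intro a b hab
    have : (Finset.univ.filter (· < a)).card + 1 ≤ (Finset.univ.filter (· < b)).card := by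
      refine Finset.card_lt_card ?_
      rw [Finset.ssubset_iff_of_subset]
      · exact ⟨a, by simp [hab], by simp⟩
      · intro x; simp only [Finset.mem_filter, Finset.mem_univ, true_and]
        exact fun h => h.trans hab
    simp only [r]
    exact_mod_cast this
  have hrm : Monotone r := by
    intro a b hab
    rcases hab.eq_or_lt with rfl | h
    · rfl
    · linarith [hr a b h]
  let h : (ι → Ω₀) → ℝ := fun ω => 2 * C * ∑ x ∈ Δ, r (ω x)
  have hhd : ∀ ω ω' : ι → Ω₀, (∀ x ∈ Δ, ω x = ω' x) → h ω = h ω' := by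
    intro ω ω' hx
    simp only [h]
    congr 1
    exact Finset.sum_congr rfl fun x hx' => by rw [hx x hx']
  have hhm : Monotone h := by
    intro ω ω' hle
    refine mul_le_mul_of_nonneg_left (Finset.sum_le_sum fun x _ => hrm (hle x)) (by linarith)
  refine ⟨fun ω => f ω + h ω, h, isLocal_of_dep θ Δ ?_, ?_, isLocal_of_dep θ Δ hhd, hhm, ?_⟩
  · intro ω ω' hx
    simp only [hΔ ω ω' hx, hhd ω ω' hx]
  · intro ω ω' hle
    by_cases hx : ∀ x ∈ Δ, ω x = ω' x
    · simp only [hΔ ω ω' hx, hhd ω ω' hx]; exact le_rfl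
    · push Not at hx
      obtain ⟨x, hxΔ, hne⟩ := hx
      have hs : ∑ x ∈ Δ, r (ω x) + 1 ≤ ∑ x ∈ Δ, r (ω' x) := by
        rw [← Finset.add_sum_erase Δ _ hxΔ, ← Finset.add_sum_erase Δ _ hxΔ]
        have h1 := hr _ _ (lt_of_le_of_ne (hle x) hne)
        have h2 : ∑ x ∈ Δ.erase x, r (ω x) ≤ ∑ x ∈ Δ.erase x, r (ω' x) :=
          Finset.sum_le_sum fun x _ => hrm (hle x)
        linarith
      have h3 := mul_le_mul_of_nonneg_left hs (by linarith : 0 ≤ 2 * C)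
      have h4 := abs_le.1 (hC ω)
      have h5 := abs_le.1 (hC ω')
      simp only [h]
      linarith
  · intro ω; ring

theorem measure_ext_mono [Fintype Ω₀] [DiscreteMeasurableSpace Ω₀] [PartialOrder Ω₀]
    (θ : ι → Ω₀) {μ ν : Measure (ι → Ω₀)} [IsProbabilityMeasure μ]
    [IsProbabilityMeasure ν]
    (h : ∀ f, IsLocal f → Monotone f → ∫ ω, f ω ∂μ = ∫ ω, f ω ∂ν) : μ = ν := by
  refine measure_ext_local θ fun f hf => ?_
  obtain ⟨g, k, hg, hgm, hk, hkm, he⟩ := local_decomp θ hf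
  simp only [he]
  rw [integral_sub (hg.integ μ) (hk.integ μ), integral_sub (hg.integ ν) (hk.integ ν),
    h g hg hgm, h k hk hkm]

theorem IsLocal.cont {f : (ι → Ω₀) → ℝ} (hf : IsLocal f) [TopologicalSpace Ω₀]
    [DiscreteTopology Ω₀] : Continuous f := by
  obtain ⟨Δ, hΔ⟩ := hf.dep
  refine continuous_iff_continuousAt.2 fun ω => ?_
  have : ∀ᶠ ω' in 𝓝 ω, ∀ x ∈ Δ, ω' x = ω x := by
    rw [Filter.eventually_all_finset]
    intro x _
    have h1 : Tendsto (fun ω' : ι → Ω₀ => ω' x) (𝓝 ω) (𝓝 (ω x)) :=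
      (continuous_apply x).continuousAt
    rw [nhds_discrete Ω₀] at h1
    exact h1.eventually (p := fun a => a = ω x) (by simp)
  exact tendsto_nhds_of_eventually_eq (this.mono fun ω' h => hΔ _ _ h)

theorem integral_le_of_le_const {f : (ι → Ω₀) → ℝ} (μ : Measure (ι → Ω₀))
    [IsProbabilityMeasure μ] (hf : Integrable f μ) {c : ℝ} (h : ∀ ω, f ω ≤ c) :
    ∫ ω, f ω ∂μ ≤ c := by
  have := integral_mono hf (integrable_const c) h
  simpa using this

theorem specInt_specInt (γ : Specification ι Ω₀) {Λ Λ' : Finset ι} (hΛ : Λ ⊆ Λ')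
    {f : (ι → Ω₀) → ℝ} (hf : Measurable f) {C : ℝ} (hC : ∀ ω, |f ω| ≤ C) (ω) :
    specInt γ Λ' (specInt γ Λ f) ω = specInt γ Λ' f ω := by
  have := γ.isProb Λ' ω
  have h := integral_bind_spec γ Λ hf hC (γ.k Λ' ω)
  rw [γ.consistent hΛ] at h
  exact h.symm

theorem gibbs_le [Fintype Ω₀] [Preorder Ω₀] {top : Ω₀} (htop : ∀ a, a ≤ top)
    (γ : Specification ι Ω₀) (Λ : Finset ι) {f : (ι → Ω₀) → ℝ} (hf : IsLocal f)
    (hm : Monotone (specInt γ Λ f)) (μ : Measure (ι → Ω₀)) [IsProbabilityMeasure μ]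
    (hμ : μ.bind (γ.k Λ) = μ) : ∫ ω, f ω ∂μ ≤ specInt γ Λ f (fun _ => top) := by
  obtain ⟨C, hC⟩ := hf.bdd
  have h := integral_bind_spec γ Λ hf.meas hC μ
  rw [hμ] at h
  rw [h]
  exact integral_le_of_le_const μ
    (integrable_of_meas_bdd (specInt_meas γ Λ hf.meas) (specInt_bdd γ Λ hC) μ)
    fun ω => hm fun x => htop _

theorem specInt_antitone [Fintype Ω₀] [Preorder Ω₀] {top : Ω₀} (htop : ∀ a, a ≤ top)
    (γ : Specification ι Ω₀) (hmono : MonoPreserving γ) {f : (ι → Ω₀) → ℝ} (hf : IsLocal f)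
    (hm : Monotone f) : Antitone (fun Λ => specInt γ Λ f (fun _ => top)) := by
  intro Λ Λ' hΛ
  have := γ.isProb Λ' (fun _ => top)
  exact gibbs_le htop γ Λ hf (hmono Λ f hf.meas hm) (γ.k Λ' (fun _ => top))
    (γ.consistent hΛ _)

theorem exists_limit [Countable ι] [Fintype Ω₀] [DiscreteMeasurableSpace Ω₀] [PartialOrder Ω₀]
    {top : Ω₀} (htop : ∀ a, a ≤ top) (γ : Specification ι Ω₀) (hmono : MonoPreserving γ) :
    ∃ μ, IsLimitWithBoundary γ (fun _ => top) μ := by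
  let _ : TopologicalSpace Ω₀ := ⊥
  have : DiscreteTopology Ω₀ := ⟨rfl⟩
  have : BorelSpace Ω₀ := inferInstance
  have : BorelSpace (ι → Ω₀) := inferInstance
  let P : Finset ι → ProbabilityMeasure (ι → Ω₀) := fun Λ => ⟨γ.k Λ (fun _ => top), γ.isProb _ _⟩
  let U : Ultrafilter (Finset ι) := Ultrafilter.of atTop
  obtain ⟨μ, -, hμ⟩ := isCompact_univ.ultrafilter_le_nhds (U.map P) (by simp)
  have hU : (U : Filter (Finset ι)) ≤ atTop := Ultrafilter.of_le _
  have hT : Tendsto P U (𝓝 μ) := hμ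
  rw [ProbabilityMeasure.tendsto_iff_forall_integral_tendsto] at hT
  have key : ∀ f, IsLocal f → Monotone f → Tendsto (fun Λ : Finset ι =>
      specInt γ Λ f (fun _ => top)) atTop (𝓝 (∫ ω, f ω ∂(μ : Measure (ι → Ω₀)))) := by
    intro f hf hm
    obtain ⟨C, hC⟩ := hf.bdd
    have h1 := tendsto_atTop_ciInf (specInt_antitone htop γ hmono hf hm)
      ⟨-C, by rintro _ ⟨Λ, rfl⟩; exact (abs_le.1 (specInt_bdd γ Λ hC _)).1⟩
    have h2 := hT (BoundedContinuousFunction.ofNormedAddCommGroup f hf.cont C hC)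
    have h3 := tendsto_nhds_unique (h1.mono_left hU) h2
    rw [h3] at h1
    exact h1
  refine ⟨μ, μ.2, fun f hf => ?_⟩
  obtain ⟨g, h, hg, hgm, hh, hhm, he⟩ := local_decomp (fun _ => top) hf
  have h1 := (key g hg hgm).sub (key h hh hhm)
  rw [← integral_sub (hg.integ _) (hh.integ _)] at h1
  simp only [← he] at h1
  refine h1.congr fun Λ => ?_
  have := γ.isProb Λ (fun _ => top)
  simp only [specInt]
  rw [← integral_sub (hg.integ _) (hh.integ _)]
  simp only [← he]

theorem splice_mono [Preorder Ω₀] (S : Set ι) (θ : ι → Ω₀) : Monotone fun ω => splice S ω θ := by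
  intro ω ω' h x
  simp only [splice]
  split_ifs
  · exact h x
  · exact le_rfl

theorem plus_main [Countable ι] [Fintype Ω₀] [DiscreteMeasurableSpace Ω₀] [PartialOrder Ω₀]
    {top : Ω₀} (htop : ∀ a, a ≤ top) (γ γp : Specification ι Ω₀) (hmono : MonoPreserving γ)
    (hγp : IsDirLimitSpec γ γp (fun _ => top)) :
    ∃ μ, IsLimitWithBoundary γ (fun _ => top) μ ∧ IsGibbs γp μ ∧ IsExtremeIn γp μ ∧
      ∀ f, IsLocal f → Monotone f → ∀ ν : Measure (ι → Ω₀), IsProbabilityMeasure ν →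
        IsGibbs γ ν → ∫ ω, f ω ∂ν ≤ ∫ ω, f ω ∂μ := by
  obtain ⟨μ, hμ⟩ := exists_limit htop γ hmono
  have hμp : IsProbabilityMeasure μ := hμ.1
  have hlim := hμ.2
  -- the limit lies below every finite volume value
  have hinf : ∀ f, IsLocal f → Monotone f → ∀ Λ,
      ∫ ω, f ω ∂μ ≤ specInt γ Λ f (fun _ => top) := fun f hf hm Λ =>
    (specInt_antitone htop γ hmono hf hm).le_of_tendsto (hlim f hf) Λ
  have hpm : ∀ Λ f, IsLocal f → Monotone f → Monotone (specInt γp Λ f) := by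
    intro Λ f hf hm ω ω' h
    exact le_of_tendsto_of_tendsto' (hγp Λ f hf ω) (hγp Λ f hf ω')
      fun S => hmono Λ f hf.meas hm (splice_mono _ _ h)
  have htopeq : ∀ Λ f, IsLocal f →
      specInt γp Λ f (fun _ => top) = specInt γ Λ f (fun _ => top) := by
    intro Λ f hf
    have h1 := hγp Λ f hf (fun _ => top)
    have h2 : ∀ S : Set ι, splice S (fun _ => top) (fun _ => top) = (fun _ : ι => top) := by
      intro S; funext x; simp [splice]
    simp only [h2] at h1
    exact tendsto_nhds_unique h1 tendsto_const_nhds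
  have hbr : ∀ f, IsLocal f → Monotone f → ∀ ν : Measure (ι → Ω₀), IsProbabilityMeasure ν →
        IsGibbs γp ν → ∫ ω, f ω ∂ν ≤ ∫ ω, f ω ∂μ := by
    intro f hf hm ν hν hG
    refine ge_of_tendsto' (hlim f hf) fun Λ => ?_
    rw [← htopeq Λ f hf]
    exact gibbs_le htop γp Λ hf (hpm Λ f hf hm) ν (hG Λ)
  refine ⟨μ, hμ, ?_, ?_, ?_⟩
  · intro Λ
    have hpb := isProb_bind γp Λ μ
    refine measure_ext_mono (fun _ => top) fun f hf hm => ?_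
    obtain ⟨C, hC⟩ := hf.bdd
    rw [integral_bind_spec γp Λ hf.meas hC]
    let g : Finset ι → (ι → Ω₀) → ℝ := fun S ω =>
      specInt γ Λ f (splice (S : Set ι) ω (fun _ => top))
    have hgl : ∀ S, IsLocal (g S) := by
      intro S
      refine isLocal_of_dep (fun _ => top) S fun ω ω' h => ?_
      simp only [g]
      congr 1
      funext x
      simp only [splice]
      split_ifs with hx
      · exact h x hx
      · rfl
    have hgm : ∀ S, Monotone (g S) := fun S ω ω' h =>
      hmono Λ f hf.meas hm (splice_mono _ _ h)
    have hgT : Tendsto (fun S => ∫ ω, g S ω ∂μ) atTop (𝓝 (∫ ω, specInt γp Λ f ω ∂μ)) := by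
      refine tendsto_integral_filter_of_dominated_convergence (fun _ => C) ?_ ?_
        (integrable_const C) ?_
      · exact Eventually.of_forall fun S => (hgl S).meas.aestronglyMeasurable
      · exact Eventually.of_forall fun S => Eventually.of_forall fun ω =>
          specInt_bdd γ Λ hC _
      · exact Eventually.of_forall fun ω => hγp Λ f hf ω
    apply le_antisymm
    · refine le_of_tendsto_of_tendsto hgT (hlim f hf) ?_
      filter_upwards [eventually_ge_atTop Λ] with S hS
      refine (hinf (g S) (hgl S) (hgm S) S).trans (le_of_eq ?_)
      rw [← specInt_specInt γ hS hf.meas hC]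
      refine integral_congr_ae ?_
      have hB : MeasurableSet[cylinderSigma Ω₀ ((S : Set ι))ᶜ]
          {ω : ι → Ω₀ | ∀ x : ↥((S : Set ι)ᶜ), ω x = top} := by
        refine ⟨{η | ∀ x, η x = top}, ?_, rfl⟩
        have hc : {η : ↥((S : Set ι)ᶜ) → Ω₀ | ∀ x, η x = top} =
            ⋂ x, (fun η : ↥((S : Set ι)ᶜ) → Ω₀ => η x) ⁻¹' {top} := by
          ext η; simp
        rw [hc]
        exact MeasurableSet.iInter fun x =>
          (measurable_pi_apply x) (measurableSet_singleton top)
      have h1 := γ.proper S _ hB (fun _ => top)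
      have := γ.isProb S (fun _ => top)
      have h2 : ∀ᵐ ω ∂(γ.k S (fun _ => top)), ∀ x : ↥((S : Set ι)ᶜ), ω x = top := by
        rw [Set.indicator_of_mem (by simp), Pi.one_apply] at h1
        exact (mem_ae_iff_prob_eq_one (cylinderSigma_le _ _ hB)).2 h1
      filter_upwards [h2] with ω hω
      simp only [g]
      congr 1
      funext x
      simp only [splice]
      split_ifs with hx
      · rfl
      · exact (hω ⟨x, hx⟩).symm
    · refine ge_of_tendsto' hgT fun S => ?_
      refine le_of_tendsto_of_tendsto (hlim f hf) (hlim (g S) (hgl S)) ?_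
      filter_upwards [eventually_ge_atTop Λ] with Λ' hΛ'
      rw [← specInt_specInt γ hΛ' hf.meas hC]
      have := γ.isProb Λ' (fun _ => top)
      refine integral_mono (integrable_of_meas_bdd (specInt_meas γ Λ hf.meas)
        (specInt_bdd γ Λ hC) _) ((hgl S).integ _) fun ω => ?_
      refine hmono Λ f hf.meas hm fun x => ?_
      simp only [splice]
      split_ifs
      · exact le_rfl
      · exact htop _
  · intro μ₁ μ₂ h₁ h₂ hG₁ hG₂ t ht0 ht1 he
    have htt : t ≠ ⊤ := (ht1.trans ENNReal.one_lt_top).ne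
    refine measure_ext_mono (fun _ => top) fun f hf hm => ?_
    have e1 := hbr f hf hm μ₁ h₁ hG₁
    have e2 := hbr f hf hm μ₂ h₂ hG₂
    have e3 : ∫ ω, f ω ∂μ = t.toReal * ∫ ω, f ω ∂μ₁ + (1 - t.toReal) * ∫ ω, f ω ∂μ₂ := by
      rw [he, integral_add_measure ((hf.integ μ₁).smul_measure htt)
        ((hf.integ μ₂).smul_measure (by finiteness)), integral_smul_measure,
        integral_smul_measure, ENNReal.toReal_sub_of_le ht1.le (by simp)]
      simp
    have t0 : 0 < t.toReal := ENNReal.toReal_pos ht0.ne' htt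
    have t1 : t.toReal < 1 := by
      have := (ENNReal.toReal_lt_toReal htt (by simp)).2 ht1
      simpa using this
    apply le_antisymm <;> nlinarith
  · intro f hf hm ν hν hG
    exact ge_of_tendsto' (hlim f hf) fun Λ =>
      gibbs_le htop γ Λ hf (hmono Λ f hf.meas hm) ν (hG Λ)

theorem transInv_of_limit [Fintype Ω₀] [DiscreteMeasurableSpace Ω₀] {d : ℕ}
    (γ : Specification (Site d) Ω₀) (a : Ω₀) (μ : Measure (Site d → Ω₀))
    (hμ : IsLimitWithBoundary γ (fun _ => a) μ) (hγ : TransInvSpec γ) : TransInv μ := by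
  intro i
  have hμp : IsProbabilityMeasure μ := hμ.1
  have hsm : Measurable (shift (Ω₀ := Ω₀) i) :=
    measurable_pi_lambda _ fun x => measurable_pi_apply _
  have := Measure.isProbabilityMeasure_map (μ := μ) hsm.aemeasurable
  refine measure_ext_local (fun _ => a) fun f hf => ?_
  rw [integral_map hsm.aemeasurable hf.meas.aestronglyMeasurable]
  obtain ⟨Δ, hΔ⟩ := hf.dep
  have hfl : IsLocal fun ω => f (shift i ω) := by
    refine isLocal_of_dep (fun _ => a) (Δ.image (· - i)) fun ω ω' h => hΔ _ _ fun x hx => ?_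
    exact h _ (Finset.mem_image_of_mem _ hx)
  have h1 := hμ.2 _ hfl
  have hT : Tendsto (fun Λ : Finset (Site d) => Λ.image (· + i)) atTop atTop := by
    refine tendsto_atTop_atTop.2 fun Λ => ⟨Λ.image (· - i), fun Λ' h x hx => ?_⟩
    exact Finset.mem_image.2 ⟨x - i, h (Finset.mem_image_of_mem _ hx), by simp⟩
  have h2 := (hμ.2 f hf).comp hT
  refine tendsto_nhds_unique h1 (h2.congr fun Λ => ?_)
  have h3 := hγ i Λ (fun _ => a)
  have h4 : shift i (fun _ => a) = (fun _ : Site d => a) := rfl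
  rw [h4] at h3
  simp only [Function.comp, specInt]
  rw [h3, integral_map hsm.aemeasurable hf.meas.aestronglyMeasurable]

end Helpers

/-- For a monotonicity-preserving specification the limits `μ± = lim_{Λ↑𝕃} γ_Λ(·|±)`
exist, are extremal, satisfy `μ⁺ ∈ 𝒢(γ⁺)`, `μ⁻ ∈ 𝒢(γ⁻)`, are translation invariant if
`γ` is, and bracket every `μ ∈ 𝒢(γ)` on increasing local functions. -/
theorem mono_spec_plus_minus_measures
    {Ω₀ : Type*} [Fintype Ω₀] [MeasurableSpace Ω₀] [DiscreteMeasurableSpace Ω₀]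
    [LinearOrder Ω₀] [BoundedOrder Ω₀] {d : ℕ}
    (γ : Specification (Site d) Ω₀) (hmono : MonoPreserving γ)
    (γp γm : Specification (Site d) Ω₀)
    (hγp : IsDirLimitSpec γ γp (fun _ => (⊤ : Ω₀)))
    (hγm : IsDirLimitSpec γ γm (fun _ => (⊥ : Ω₀))) :
    ∃ μp μm : Measure (Site d → Ω₀),
      IsLimitWithBoundary γ (fun _ => (⊤ : Ω₀)) μp ∧
      IsLimitWithBoundary γ (fun _ => (⊥ : Ω₀)) μm ∧
      IsGibbs γp μp ∧ IsGibbs γm μm ∧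
      IsExtremeIn γp μp ∧ IsExtremeIn γm μm ∧
      (TransInvSpec γ → TransInv μp ∧ TransInv μm) ∧
      (∀ f, IsLocal f → Monotone f →
        ∀ μ : Measure (Site d → Ω₀), IsProbabilityMeasure μ → IsGibbs γ μ →
          (∫ ω, f ω ∂μm) ≤ (∫ ω, f ω ∂μ) ∧ (∫ ω, f ω ∂μ) ≤ (∫ ω, f ω ∂μp)) := by
  obtain ⟨μp, hp1, hp2, hp3, hp4⟩ := plus_main (top := (⊤ : Ω₀)) (fun _ => le_top) γ γp hmono hγp
  obtain ⟨μm, hm1, hm2, hm3, hm4⟩ := @plus_main (Site d) Ω₀ _ _ _ _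
    (inferInstanceAs (PartialOrder Ω₀ᵒᵈ)) (⊥ : Ω₀) (fun a => (bot_le : (⊥ : Ω₀) ≤ a)) γ γm (by
      intro Λ f hf hanti ω ω' h
      have h1 : Monotone fun ω => - f ω := fun x y hxy => neg_le_neg (hanti hxy)
      have h2 := hmono Λ _ hf.neg h1 (show ω' ≤ ω from h)
      simp only [specInt, Pi.neg_apply, integral_neg] at h2
      exact neg_le_neg_iff.1 h2) hγm
  refine ⟨μp, μm, hp1, hm1, hp2, hm2, hp3, hm3, fun h =>
    ⟨transInv_of_limit γ _ μp hp1 h, transInv_of_limit γ _ μm hm1 h⟩, ?_⟩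
  intro f hf hf' μ hμ hG
  refine ⟨?_, hp4 f hf hf' μ hμ hG⟩
  have h1 : IsLocal fun ω => - f ω := by
    obtain ⟨Δ, hΔ⟩ := hf.dep
    exact isLocal_of_dep (fun _ => ⊤) Δ fun ω ω' h => by rw [hΔ ω ω' h]
  have h2 := hm4 (fun ω => - f ω) h1 (fun x y hxy => neg_le_neg (hf' hxy)) μ hμ hG
  simp only [integral_neg] at h2
  exact neg_le_neg_iff.1 h2

end
end

section
/- Let γ be a monotonicity-preserving specification and μ± = lim_{Λ↑𝕃} γ_Λ(·|±) the associated extremal measures. For each (finite or infinite) subset D ⊂ 𝕃, the conditional expectations μ⁺(f|ℱ_D) and μ⁻(f|ℱ_D) admit everywhere-defined versions that are monotonicity preserving and right (resp. left) continuous; these versions come from global specifications, i.e. from families of proper consistent probability kernels indexed by all (also infinite) subsets Λ ⊂ 𝕃. Furthermore, for these versions, μ⁻(f|ℱ_D) ≤ μ⁺(f|ℱ_D) pointwise for every increasing f. -/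
open MeasureTheory Filter Topology
open scoped ENNReal MeasureTheory Classical

noncomputable section

/-- A global specification: a proper consistent family of probability kernels indexed
by all (finite or infinite) subsets of the site space. -/
structure GlobalSpecification (ι Ω₀ : Type*) [MeasurableSpace Ω₀] where
  k : Set ι → (ι → Ω₀) → Measure (ι → Ω₀)
  isProb : ∀ Λ ω, IsProbabilityMeasure (k Λ ω)
  meas : ∀ (Λ : Set ι) (A : Set (ι → Ω₀)), MeasurableSet A →
    Measurable[cylinderSigma Ω₀ Λᶜ] (fun ω => k Λ ω A)
  proper : ∀ (Λ : Set ι) (B : Set (ι → Ω₀)),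
    MeasurableSet[cylinderSigma Ω₀ Λᶜ] B → ∀ ω, k Λ ω B = B.indicator 1 ω
  consistent : ∀ ⦃Λ Λ' : Set ι⦄, Λ ⊆ Λ' → ∀ ω, (k Λ' ω).bind (k Λ) = k Λ' ω

/-! ### Basic facts on cylinder σ-algebras -/

theorem gs_cyl_mem_congr {ι Ω₀ : Type*} [MeasurableSpace Ω₀] {Δ : Set ι} {B : Set (ι → Ω₀)}
    (hB : MeasurableSet[cylinderSigma Ω₀ Δ] B) {ω ω' : ι → Ω₀}
    (h : ∀ x ∈ Δ, ω x = ω' x) : ω ∈ B ↔ ω' ∈ B := by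
  obtain ⟨T, -, rfl⟩ := hB
  have : (fun x : Δ => ω (x : ι)) = fun x : Δ => ω' (x : ι) := funext fun x => h x x.2
  simp only [Set.mem_preimage, this]

theorem gs_cyl_congr {ι Ω₀ β : Type*} [MeasurableSpace Ω₀] [MeasurableSpace β]
    [MeasurableSingletonClass β] {Δ : Set ι} {f : (ι → Ω₀) → β}
    (hf : Measurable[cylinderSigma Ω₀ Δ] f) {ω ω' : ι → Ω₀}
    (h : ∀ x ∈ Δ, ω x = ω' x) : f ω = f ω' := by
  have hB : MeasurableSet[cylinderSigma Ω₀ Δ] (f ⁻¹' {f ω'}) := hf (measurableSet_singleton _)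
  exact (gs_cyl_mem_congr hB h).2 rfl

theorem gs_cyl_le {ι Ω₀ : Type*} [MeasurableSpace Ω₀] (Δ : Set ι) :
    cylinderSigma Ω₀ Δ ≤ MeasurableSpace.pi := by
  unfold cylinderSigma
  rw [← measurable_iff_comap_le]
  exact measurable_pi_lambda _ fun x => measurable_pi_apply _

theorem gs_splice_apply {ι Ω₀ : Type*} (S : Set ι) (ω θ : ι → Ω₀) (x : ι) :
    splice S ω θ x = if x ∈ S then ω x else θ x := rfl

theorem gs_cyl_measurable {ι Ω₀ β : Type*} [Finite Ω₀] [MeasurableSpace Ω₀]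
    [DiscreteMeasurableSpace Ω₀] [Nonempty Ω₀] [MeasurableSpace β] {Δ : Set ι} (S : Finset ι)
    (hS : (S : Set ι) ⊆ Δ) {f : (ι → Ω₀) → β}
    (hf : ∀ ω ω', (∀ x ∈ S, ω x = ω' x) → f ω = f ω') :
    Measurable[cylinderSigma Ω₀ Δ] f := by
  let r : (ι → Ω₀) → (S → Ω₀) := fun ω x => ω x
  have hr : Measurable[cylinderSigma Ω₀ Δ] r := by
    have : r = (fun (η : Δ → Ω₀) (x : S) => η ⟨x, hS x.2⟩) ∘
      (fun ω (x : Δ) => ω (x : ι)) := rfl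
    rw [this]
    exact Measurable.comp (measurable_pi_lambda _ fun x => measurable_pi_apply _)
      (comap_measurable _)
  let θ : Ω₀ := Classical.arbitrary Ω₀
  let e : (S → Ω₀) → (ι → Ω₀) := fun η x => if h : x ∈ S then η ⟨x, h⟩ else θ
  have hfe : f = (f ∘ e) ∘ r := by
    funext ω
    refine hf _ _ fun x hx => ?_
    simp [e, r, hx]
  rw [hfe]
  exact (measurable_of_finite (f ∘ e)).comp hr

theorem gs_isLocal_of {ι Ω₀ : Type*} [Finite Ω₀] [MeasurableSpace Ω₀]
    [DiscreteMeasurableSpace Ω₀] [Nonempty Ω₀] (S : Finset ι) {f : (ι → Ω₀) → ℝ}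
    (hf : ∀ ω ω', (∀ x ∈ S, ω x = ω' x) → f ω = f ω') : IsLocal f :=
  ⟨S, gs_cyl_measurable S subset_rfl hf⟩

theorem gs_local_dep {ι Ω₀ : Type*} [MeasurableSpace Ω₀] {f : (ι → Ω₀) → ℝ}
    (hf : IsLocal f) : ∃ S : Finset ι, ∀ ω ω', (∀ x ∈ S, ω x = ω' x) → f ω = f ω' := by
  obtain ⟨S, hS⟩ := hf
  exact ⟨S, fun ω ω' h => gs_cyl_congr hS h⟩

theorem gs_local_measurable {ι Ω₀ : Type*} [MeasurableSpace Ω₀] {f : (ι → Ω₀) → ℝ}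
    (hf : IsLocal f) : Measurable f := by
  obtain ⟨S, hS⟩ := hf
  exact hS.mono (gs_cyl_le _) le_rfl

/-- A local function factors through a finite product. -/
theorem gs_local_factor {ι Ω₀ : Type*} [MeasurableSpace Ω₀] [Nonempty Ω₀]
    {f : (ι → Ω₀) → ℝ} (hf : IsLocal f) :
    ∃ (S : Finset ι) (g : (S → Ω₀) → ℝ), ∀ ω, f ω = g (fun x => ω x) := by
  obtain ⟨S, hS⟩ := gs_local_dep hf
  let θ : Ω₀ := Classical.arbitrary Ω₀
  refine ⟨S, fun η => f fun x => if h : x ∈ S then η ⟨x, h⟩ else θ, fun ω => ?_⟩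
  refine hS _ _ fun x hx => ?_
  simp [hx]

theorem gs_local_bdd {ι Ω₀ : Type*} [Finite Ω₀] [MeasurableSpace Ω₀] [Nonempty Ω₀]
    {f : (ι → Ω₀) → ℝ} (hf : IsLocal f) : ∃ C : ℝ, ∀ ω, |f ω| ≤ C := by
  obtain ⟨S, g, hg⟩ := gs_local_factor hf
  obtain ⟨C, hC⟩ := (Set.finite_range fun η => |g η|).bddAbove
  exact ⟨C, fun ω => hg ω ▸ hC ⟨_, rfl⟩⟩

theorem gs_integrable {α : Type*} [MeasurableSpace α] (μ : Measure α) [IsFiniteMeasure μ]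
    {f : α → ℝ} (hf : Measurable f) {C : ℝ} (hC : ∀ ω, |f ω| ≤ C) : Integrable f μ :=
  Integrable.of_bound hf.aestronglyMeasurable C (Eventually.of_forall fun ω => by
    simpa using hC ω)

theorem gs_local_integrable {ι Ω₀ : Type*} [Finite Ω₀] [MeasurableSpace Ω₀] [Nonempty Ω₀]
    {f : (ι → Ω₀) → ℝ} (hf : IsLocal f) (μ : Measure (ι → Ω₀)) [IsFiniteMeasure μ] :
    Integrable f μ := by
  obtain ⟨C, hC⟩ := gs_local_bdd hf
  exact gs_integrable μ (gs_local_measurable hf) hC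

/-- Every local function is a difference of two increasing local functions. -/
theorem gs_local_decomp {ι Ω₀ : Type*} [Finite Ω₀] [MeasurableSpace Ω₀]
    [DiscreteMeasurableSpace Ω₀] [Nonempty Ω₀] [PartialOrder Ω₀]
    {f : (ι → Ω₀) → ℝ} (hf : IsLocal f) :
    ∃ f₁ f₂ : (ι → Ω₀) → ℝ, IsLocal f₁ ∧ Monotone f₁ ∧ IsLocal f₂ ∧ Monotone f₂ ∧
      f = fun ω => f₁ ω - f₂ ω := by
  obtain ⟨S, g, hg⟩ := gs_local_factor hf
  obtain ⟨C, hC⟩ := (Set.finite_range fun η => |g η|).bddAbove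
  have hC' : ∀ η, |g η| ≤ C := fun η => hC ⟨η, rfl⟩
  have hC0 : 0 ≤ C := (abs_nonneg _).trans (hC' fun _ => Classical.arbitrary Ω₀)
  let h : (S → Ω₀) → ℝ := fun η => 2 * C * ((Set.Iic η).ncard : ℝ)
  have hh : Monotone h := by
    intro a b hab
    have : (Set.Iic a).ncard ≤ (Set.Iic b).ncard :=
      Set.ncard_le_ncard (Set.Iic_subset_Iic.2 hab) (Set.toFinite _)
    have : ((Set.Iic a).ncard : ℝ) ≤ (Set.Iic b).ncard := by exact_mod_cast this
    simp only [h]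
    gcongr
  have hgh : Monotone fun η => g η + h η := by
    intro a b hab
    rcases hab.eq_or_lt with rfl | hlt
    · exact le_rfl
    have : (Set.Iic a).ncard < (Set.Iic b).ncard :=
      Set.ncard_lt_ncard (Set.Iic_ssubset_Iic.2 hlt) (Set.toFinite _)
    have : ((Set.Iic a).ncard : ℝ) + 1 ≤ (Set.Iic b).ncard := by exact_mod_cast this
    have h1 := abs_le.1 (hC' a)
    have h2 := abs_le.1 (hC' b)
    simp only [h]
    nlinarith
  refine ⟨fun ω => g (fun x => ω x) + h (fun x => ω x), fun ω => h (fun x => ω x),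
    gs_isLocal_of S ?_, ?_, gs_isLocal_of S ?_, ?_, ?_⟩
  · intro ω ω' hω
    have : (fun x : S => ω x) = fun x : S => ω' x := funext fun x => hω x x.2
    simp only [this]
  · intro ω ω' hω
    exact hgh fun x => hω x
  · intro ω ω' hω
    have : (fun x : S => ω x) = fun x : S => ω' x := funext fun x => hω x x.2
    simp only [this]
  · intro ω ω' hω
    exact hh fun x => hω x
  · funext ω
    rw [hg]; ring

theorem gs_indicator_local {ι Ω₀ : Type*} [Finite Ω₀] [MeasurableSpace Ω₀]
    [DiscreteMeasurableSpace Ω₀] [Nonempty Ω₀] {A : Set (ι → Ω₀)}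
    (hA : A ∈ measurableCylinders fun _ : ι => Ω₀) :
    IsLocal (A.indicator (fun _ => (1 : ℝ))) := by
  obtain ⟨S, T, -, rfl⟩ := (mem_measurableCylinders _).1 hA
  refine gs_isLocal_of S fun ω ω' h => ?_
  exact dependsOn_cylinder_indicator_const T (1 : ℝ) h

/-- Probability measures are determined by integrals of local functions. -/
theorem gs_ext {ι Ω₀ : Type*} [Finite Ω₀] [MeasurableSpace Ω₀]
    [DiscreteMeasurableSpace Ω₀] [Nonempty Ω₀] {μ ν : Measure (ι → Ω₀)}
    [IsProbabilityMeasure μ] [IsProbabilityMeasure ν]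
    (h : ∀ f, IsLocal f → ∫ x, f x ∂μ = ∫ x, f x ∂ν) : μ = ν := by
  refine ext_of_generate_finite (measurableCylinders fun _ : ι => Ω₀)
    generateFrom_measurableCylinders.symm isPiSystem_measurableCylinders ?_ (by simp)
  intro A hA
  have hm : MeasurableSet A := .of_mem_measurableCylinders hA
  have := h _ (gs_indicator_local hA)
  rw [integral_indicator_const _ hm, integral_indicator_const _ hm] at this
  simp only [smul_eq_mul, mul_one] at this
  exact (measureReal_eq_measureReal_iff).1 this

theorem gs_ext_mono {ι Ω₀ : Type*} [Finite Ω₀] [MeasurableSpace Ω₀]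
    [DiscreteMeasurableSpace Ω₀] [Nonempty Ω₀] [PartialOrder Ω₀] {μ ν : Measure (ι → Ω₀)}
    [IsProbabilityMeasure μ] [IsProbabilityMeasure ν]
    (h : ∀ f, IsLocal f → Monotone f → ∫ x, f x ∂μ = ∫ x, f x ∂ν) : μ = ν := by
  refine gs_ext fun f hf => ?_
  obtain ⟨f₁, f₂, h1, m1, h2, m2, rfl⟩ := gs_local_decomp hf
  rw [integral_sub (gs_local_integrable h1 _) (gs_local_integrable h2 _),
    integral_sub (gs_local_integrable h1 _) (gs_local_integrable h2 _), h _ h1 m1, h _ h2 m2]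

theorem gs_local_continuous {ι Ω₀ : Type*} [MeasurableSpace Ω₀] [Nonempty Ω₀]
    [TopologicalSpace Ω₀] [DiscreteTopology Ω₀] {f : (ι → Ω₀) → ℝ} (hf : IsLocal f) :
    Continuous f := by
  obtain ⟨S, g, hg⟩ := gs_local_factor hf
  have : f = g ∘ fun ω (x : S) => ω x := funext hg
  rw [this]
  exact continuous_of_discreteTopology.comp (by fun_prop)

/-- A net of probability measures whose integrals of local functions converge has a limit. -/
theorem gs_exists_limit {ι Ω₀ κ : Type*} [Countable ι] [Finite Ω₀] [MeasurableSpace Ω₀]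
    [DiscreteMeasurableSpace Ω₀] [Nonempty Ω₀] (F : Filter κ) [F.NeBot]
    (ν : κ → Measure (ι → Ω₀)) (hν : ∀ i, IsProbabilityMeasure (ν i))
    (h : ∀ f, IsLocal f → ∃ c, Tendsto (fun i => ∫ x, f x ∂(ν i)) F (𝓝 c)) :
    ∃ μ : Measure (ι → Ω₀), IsProbabilityMeasure μ ∧
      ∀ f, IsLocal f → Tendsto (fun i => ∫ x, f x ∂(ν i)) F (𝓝 (∫ x, f x ∂μ)) := by
  let _ : TopologicalSpace Ω₀ := ⊥
  have : DiscreteTopology Ω₀ := ⟨rfl⟩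
  have : BorelSpace Ω₀ := ⟨by
    rw [borel_eq_top_of_discrete]
    exact top_le_iff.1 fun s _ => MeasurableSet.of_discrete⟩
  let P : κ → ProbabilityMeasure (ι → Ω₀) := fun i => ⟨ν i, hν i⟩
  let U : Ultrafilter κ := Ultrafilter.of F
  obtain ⟨μ, -, hμ⟩ := isCompact_univ (X := ProbabilityMeasure (ι → Ω₀)).ultrafilter_le_nhds
    (U.map P) (by simp)
  refine ⟨μ, inferInstance, fun f hf => ?_⟩
  obtain ⟨c, hc⟩ := h f hf
  obtain ⟨C, hC⟩ := gs_local_bdd hf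
  have hT : Tendsto P U (𝓝 μ) := hμ
  rw [ProbabilityMeasure.tendsto_iff_forall_integral_tendsto] at hT
  have h1 := hT (BoundedContinuousFunction.ofNormedAddCommGroup f (gs_local_continuous hf) C
    (fun x => by simpa using hC x))
  have h2 : Tendsto (fun i => ∫ x, f x ∂(ν i)) U (𝓝 c) := hc.mono_left (Ultrafilter.of_le F)
  have h3 : Tendsto (fun i => ∫ x, f x ∂(ν i)) U (𝓝 (∫ x, f x ∂(μ : Measure (ι → Ω₀)))) := h1
  rwa [tendsto_nhds_unique h3 h2]

/-- Stochastic domination can be tested on local increasing functions: upper sets. -/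
theorem gs_dom_set {ι Ω₀ : Type*} [Countable ι] [Finite Ω₀] [MeasurableSpace Ω₀]
    [DiscreteMeasurableSpace Ω₀] [PartialOrder Ω₀] [OrderTop Ω₀] {μ ν : Measure (ι → Ω₀)}
    [IsProbabilityMeasure μ] [IsProbabilityMeasure ν]
    (h : ∀ f, IsLocal f → Monotone f → ∫ x, f x ∂μ ≤ ∫ x, f x ∂ν)
    {A : Set (ι → Ω₀)} (hA : MeasurableSet A) (hup : IsUpperSet A) : μ A ≤ ν A := by
  let _ : TopologicalSpace Ω₀ := ⊥
  have : DiscreteTopology Ω₀ := ⟨rfl⟩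
  have : BorelSpace Ω₀ := ⟨by
    rw [borel_eq_top_of_discrete]
    exact top_le_iff.1 fun s _ => MeasurableSet.of_discrete⟩
  have hne : Nonempty Ω₀ := ⟨⊤⟩
  rw [hA.measure_eq_iSup_isCompact]
  refine iSup₂_le fun K hK => iSup_le fun hKc => ?_
  -- the up-closure of `K` is compact
  have hleclosed : IsClosed {p : (ι → Ω₀) × (ι → Ω₀) | p.1 ≤ p.2} := by
    have : {p : (ι → Ω₀) × (ι → Ω₀) | p.1 ≤ p.2} =
        ⋂ x, (fun p : (ι → Ω₀) × (ι → Ω₀) => (p.1 x, p.2 x)) ⁻¹' {q | q.1 ≤ q.2} := by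
      ext p; simp [Pi.le_def]
    rw [this]
    exact isClosed_iInter fun x => (isClosed_discrete _).preimage (by fun_prop)
  let U : Set (ι → Ω₀) := Prod.snd '' ((K ×ˢ Set.univ) ∩ {p : (ι → Ω₀) × (ι → Ω₀) | p.1 ≤ p.2})
  have hUc : IsCompact U := ((hKc.prod isCompact_univ).inter_right hleclosed).image continuous_snd
  have hUclosed : IsClosed U := hUc.isClosed
  have hKU : K ⊆ U := fun x hx => ⟨(x, x), ⟨⟨hx, trivial⟩, le_refl x⟩, rfl⟩
  have hUA : U ⊆ A := by
    rintro _ ⟨⟨x, y⟩, ⟨⟨hx, -⟩, hxy⟩, rfl⟩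
    exact hup hxy (hK hx)
  have hUup : IsUpperSet U := by
    rintro a b hab ⟨⟨x, y⟩, ⟨⟨hx, -⟩, hxy⟩, rfl⟩
    exact ⟨(x, b), ⟨⟨hx, trivial⟩, le_trans hxy hab⟩, rfl⟩
  -- local approximations of `U`
  let W : Finset ι → Set (ι → Ω₀) := fun S => {ω | splice (S : Set ι) ω (fun _ => ⊤) ∈ U}
  have hWloc : ∀ S, IsLocal ((W S).indicator fun _ => (1 : ℝ)) := by
    intro S
    refine gs_isLocal_of S fun ω ω' hω => ?_
    have : splice (S : Set ι) ω (fun _ => ⊤) = splice (S : Set ι) ω' (fun _ => ⊤) := by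
      funext x
      simp only [gs_splice_apply, Finset.mem_coe]
      split_ifs with hx
      · exact hω x hx
      · rfl
    simp only [Set.indicator, W, Set.mem_ofPred_eq, this]
  have hWm : ∀ S, MeasurableSet (W S) := by
    intro S
    have := gs_local_measurable (hWloc S) (measurableSet_singleton (1 : ℝ))
    convert this using 1
    ext ω
    by_cases hω : ω ∈ W S <;> simp [hω]
  have hWmono : ∀ S, Monotone ((W S).indicator fun _ => (1 : ℝ)) := by
    intro S a b hab
    have : splice (S : Set ι) a (fun _ => ⊤) ≤ splice (S : Set ι) b (fun _ => ⊤) := by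
      intro x
      simp only [gs_splice_apply]
      split_ifs
      · exact hab x
      · exact le_rfl
    by_cases ha : a ∈ W S
    · have hb : b ∈ W S := hUup this ha
      simp [ha, hb]
    · simp only [ha, Set.indicator_of_notMem, not_false_eq_true]
      exact Set.indicator_nonneg (fun _ _ => zero_le_one) _
  have hWle : ∀ S, μ (W S) ≤ ν (W S) := by
    intro S
    have := h _ (hWloc S) (hWmono S)
    rw [integral_indicator_const _ (hWm S), integral_indicator_const _ (hWm S)] at this
    simp only [smul_eq_mul, mul_one] at this
    exact (ENNReal.toReal_le_toReal (measure_ne_top _ _) (measure_ne_top _ _)).1 this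
  have hUW : ∀ S, U ⊆ W S := by
    intro S ω hω
    refine hUup (fun x => ?_) hω
    simp only [gs_splice_apply]
    split_ifs
    · exact le_rfl
    · exact le_top
  have hWanti : Antitone W := by
    intro S T hST ω hω
    refine hUup (fun x => ?_) hω
    simp only [gs_splice_apply, Finset.mem_coe]
    by_cases hx : x ∈ S
    · simp [hx, hST hx]
    · simp [hx]
  have hWU : ⋂ S, W S = U := by
    refine Set.Subset.antisymm (fun ω hω => ?_) (Set.subset_iInter hUW)
    have hω' : ∀ S : Finset ι, splice (S : Set ι) ω (fun _ => ⊤) ∈ U := fun S =>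
      Set.mem_iInter.1 hω S
    refine hUclosed.mem_of_tendsto (f := fun S : Finset ι => splice (S : Set ι) ω (fun _ => ⊤))
      (b := atTop) ?_ (Eventually.of_forall hω')
    rw [tendsto_pi_nhds]
    intro x
    refine tendsto_const_nhds.congr' ?_
    filter_upwards [eventually_ge_atTop ({x} : Finset ι)] with S hS
    have : x ∈ S := hS (Finset.mem_singleton_self x)
    simp [gs_splice_apply, this]
  have hlim : Tendsto (fun S => ν (W S)) atTop (𝓝 (ν U)) := by
    rw [← hWU]
    exact tendsto_measure_iInter_atTop (fun S => (hWm S).nullMeasurableSet) hWanti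
      ⟨∅, measure_ne_top _ _⟩
  calc μ K ≤ μ U := measure_mono hKU
    _ ≤ ν U := ge_of_tendsto' hlim fun S => (measure_mono (hUW S)).trans (hWle S)
    _ ≤ ν A := measure_mono hUA

/-- Stochastic domination can be tested on local increasing functions. -/
theorem gs_dom {ι Ω₀ : Type*} [Countable ι] [Finite Ω₀] [MeasurableSpace Ω₀]
    [DiscreteMeasurableSpace Ω₀] [PartialOrder Ω₀] [BoundedOrder Ω₀] {μ ν : Measure (ι → Ω₀)}
    [IsProbabilityMeasure μ] [IsProbabilityMeasure ν]
    (h : ∀ f, IsLocal f → Monotone f → ∫ x, f x ∂μ ≤ ∫ x, f x ∂ν)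
    {f : (ι → Ω₀) → ℝ} (hf : Measurable f) (hm : Monotone f) :
    ∫ x, f x ∂μ ≤ ∫ x, f x ∂ν := by
  let g : (ι → Ω₀) → ℝ := fun ω => f ω - f ⊥
  have hg0 : ∀ ω, 0 ≤ g ω := fun ω => sub_nonneg.2 (hm bot_le)
  have hgm : Measurable g := hf.sub_const _
  have hgM : Monotone g := fun a b hab => sub_le_sub_right (hm hab) _
  have hgC : ∀ ω, |g ω| ≤ f ⊤ - f ⊥ := fun ω => by
    rw [abs_of_nonneg (hg0 ω)]
    exact sub_le_sub_right (hm le_top) _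
  have hfg : f = fun ω => g ω + f ⊥ := by funext ω; simp [g]
  rw [hfg, integral_add (gs_integrable _ hgm hgC) (integrable_const _),
    integral_add (gs_integrable _ hgm hgC) (integrable_const _)]
  simp only [integral_const, probReal_univ, smul_eq_mul, one_mul]
  suffices hs : ∫ x, g x ∂μ ≤ ∫ x, g x ∂ν by linarith
  rw [integral_eq_lintegral_of_nonneg_ae (Eventually.of_forall hg0) hgm.aestronglyMeasurable,
    integral_eq_lintegral_of_nonneg_ae (Eventually.of_forall hg0) hgm.aestronglyMeasurable]
  refine ENNReal.toReal_mono ?_ ?_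
  · exact (gs_integrable ν hgm hgC).lintegral_lt_top.ne
  · rw [lintegral_eq_lintegral_meas_lt _ (Eventually.of_forall hg0) hgm.aemeasurable,
      lintegral_eq_lintegral_meas_lt _ (Eventually.of_forall hg0) hgm.aemeasurable]
    refine lintegral_mono fun t => ?_
    refine gs_dom_set h (measurableSet_lt measurable_const hgm) ?_
    intro a b hab ha
    exact lt_of_lt_of_le ha (hgM hab)

/-- Integration against `bind`. -/
theorem gs_integral_bind {α : Type*} [MeasurableSpace α] {μ : Measure α} [IsFiniteMeasure μ]
    {k : α → Measure α} (hk : Measurable k) (hp : ∀ ω, IsProbabilityMeasure (k ω))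
    {f : α → ℝ} (hf : Measurable f) {C : ℝ} (hC : ∀ ω, |f ω| ≤ C) :
    ∫ x, f x ∂(μ.bind k) = ∫ ω, ∫ x, f x ∂(k ω) ∂μ := by
  let κ : ProbabilityTheory.Kernel α α := ⟨k, hk⟩
  have : ProbabilityTheory.IsMarkovKernel κ := ⟨hp⟩
  have hint : Integrable f (μ.bind κ) := gs_integrable _ hf hC
  have h := ProbabilityTheory.Kernel.integral_comp
    (η := κ) (κ := ProbabilityTheory.Kernel.const Unit μ) (a := ()) (f := f)
    (by simpa [ProbabilityTheory.Kernel.comp_apply] using hint)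
  rw [ProbabilityTheory.Kernel.comp_apply, ProbabilityTheory.Kernel.const_apply] at h
  exact h

theorem gs_integral_abs_le {α : Type*} [MeasurableSpace α] {μ : Measure α}
    [IsProbabilityMeasure μ] {f : α → ℝ} {C : ℝ} (hC : ∀ ω, |f ω| ≤ C) :
    |∫ x, f x ∂μ| ≤ C := by
  have := norm_integral_le_of_norm_le_const (μ := μ) (f := f) (C := C)
    (Eventually.of_forall fun x => by simpa using hC x)
  simpa using this

theorem gs_measurable_integral {α : Type*} [MeasurableSpace α]
    {k : α → Measure α} (hk : Measurable k) (hp : ∀ ω, IsProbabilityMeasure (k ω))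
    {f : α → ℝ} (hf : Measurable f) : Measurable fun ω => ∫ x, f x ∂(k ω) := by
  let κ : ProbabilityTheory.Kernel α α := ⟨k, hk⟩
  have : ProbabilityTheory.IsMarkovKernel κ := ⟨hp⟩
  have h := (hf.stronglyMeasurable.integral_kernel (κ := κ)).measurable
  exact h

/-! ### Basic facts on specifications -/

theorem gs_spec_meas {ι Ω₀ : Type*} [MeasurableSpace Ω₀] (γ : Specification ι Ω₀)
    (Λ : Finset ι) : Measurable (γ.k Λ) :=
  Measure.measurable_of_measurable_coe _ fun A hA =>
    (γ.meas Λ A hA).mono (gs_cyl_le _) le_rfl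

theorem gs_spec_congr {ι Ω₀ : Type*} [MeasurableSpace Ω₀] (γ : Specification ι Ω₀)
    (Λ : Finset ι) {ω ω' : ι → Ω₀} (h : ∀ x, x ∉ Λ → ω x = ω' x) :
    γ.k Λ ω = γ.k Λ ω' := by
  ext A hA
  exact gs_cyl_congr (γ.meas Λ A hA) fun x hx => h x (by simpa using hx)

theorem gs_fiber_meas {ι Ω₀ : Type*} [Countable ι] [MeasurableSpace Ω₀]
    [MeasurableSingletonClass Ω₀] (Δ : Set ι) (ω : ι → Ω₀) :
    MeasurableSet[cylinderSigma Ω₀ Δ] {x : ι → Ω₀ | ∀ y ∈ Δ, x y = ω y} := by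
  refine ⟨{fun x : Δ => ω x}, measurableSet_singleton _, ?_⟩
  ext x
  simp only [Set.mem_preimage, Set.mem_singleton_iff, Set.mem_ofPred_eq, funext_iff,
    Subtype.forall]

theorem gs_spec_ae {ι Ω₀ : Type*} [Countable ι] [MeasurableSpace Ω₀]
    [MeasurableSingletonClass Ω₀] (γ : Specification ι Ω₀)
    (Λ : Finset ι) (ω : ι → Ω₀) : ∀ᵐ x ∂(γ.k Λ ω), ∀ y, y ∉ Λ → x y = ω y := by
  have := γ.isProb Λ ω
  have hm := gs_fiber_meas (Ω₀ := Ω₀) ((Λ : Set ι)ᶜ) ω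
  have h1 := γ.proper Λ _ hm ω
  rw [Set.indicator_of_mem (by simp)] at h1
  have h2 := (mem_ae_iff_prob_eq_one (gs_cyl_le _ _ hm)).2 h1
  filter_upwards [h2] with x hx y hy
  exact hx y (by simpa using hy)

theorem gs_spec_consistent {ι Ω₀ : Type*} [MeasurableSpace Ω₀] (γ : Specification ι Ω₀)
    {Λ Λ' : Finset ι} (h : Λ ⊆ Λ') (ω : ι → Ω₀) {f : (ι → Ω₀) → ℝ} (hf : Measurable f)
    {C : ℝ} (hC : ∀ ω, |f ω| ≤ C) :
    ∫ x, f x ∂(γ.k Λ' ω) = ∫ x, ∫ z, f z ∂(γ.k Λ x) ∂(γ.k Λ' ω) := by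
  have := γ.isProb Λ' ω
  conv_lhs => rw [← γ.consistent h ω]
  exact gs_integral_bind (gs_spec_meas γ Λ) (γ.isProb Λ) hf hC

/-! ### The approximating kernels -/

/-- The trace of the set `L` on the finite volume `V`. -/
def gsVol {ι : Type*} (V : Finset ι) (L : Set ι) : Finset ι := V.filter (· ∈ L)

theorem gs_mem_vol {ι : Type*} {V : Finset ι} {L : Set ι} {x : ι} :
    x ∈ gsVol V L ↔ x ∈ V ∧ x ∈ L := by
  simp [gsVol]

/-- The boundary condition `ω` on `V \ L` and `θ` elsewhere. -/
def gsBc {ι Ω₀ : Type*} (θ : Ω₀) (V : Finset ι) (L : Set ι) (ω : ι → Ω₀) : ι → Ω₀ :=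
  splice ((V : Set ι) \ L) ω fun _ => θ

theorem gs_bc_apply {ι Ω₀ : Type*} (θ : Ω₀) (V : Finset ι) (L : Set ι) (ω : ι → Ω₀) (x : ι) :
    gsBc θ V L ω x = if x ∈ V ∧ x ∉ L then ω x else θ := by
  simp [gsBc, gs_splice_apply]

/-- The finite-volume approximation of the global kernel. -/
def gsApp {ι Ω₀ : Type*} [MeasurableSpace Ω₀] (γ : Specification ι Ω₀) (θ : Ω₀) (L : Set ι)
    (V : Finset ι) (ω : ι → Ω₀) : Measure (ι → Ω₀) :=
  γ.k (gsVol V L) (gsBc θ V L ω)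

theorem gs_app_prob {ι Ω₀ : Type*} [MeasurableSpace Ω₀] (γ : Specification ι Ω₀) (θ : Ω₀)
    (L : Set ι) (V : Finset ι) (ω : ι → Ω₀) : IsProbabilityMeasure (gsApp γ θ L V ω) :=
  γ.isProb _ _

theorem gs_app_dep {ι Ω₀ : Type*} [MeasurableSpace Ω₀] (γ : Specification ι Ω₀) (θ : Ω₀)
    (L : Set ι) (V : Finset ι) {ω ω' : ι → Ω₀} (h : ∀ x ∈ V, x ∉ L → ω x = ω' x) :
    gsApp γ θ L V ω = gsApp γ θ L V ω' := by
  have : gsBc θ V L ω = gsBc θ V L ω' := by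
    funext x
    simp only [gs_bc_apply]
    split_ifs with hx
    · exact h x hx.1 hx.2
    · rfl
  simp only [gsApp, this]

theorem gs_app_local {ι Ω₀ : Type*} [Finite Ω₀] [MeasurableSpace Ω₀]
    [DiscreteMeasurableSpace Ω₀] [Nonempty Ω₀] (γ : Specification ι Ω₀) (θ : Ω₀) (L : Set ι)
    (V : Finset ι) (f : (ι → Ω₀) → ℝ) : IsLocal fun ω => ∫ x, f x ∂(gsApp γ θ L V ω) :=
  gs_isLocal_of V fun ω ω' h => by
    simp only [gs_app_dep γ θ L V fun x hx _ => h x hx]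

theorem gs_app_mono {ι Ω₀ : Type*} [MeasurableSpace Ω₀] [PartialOrder Ω₀]
    (γ : Specification ι Ω₀) (hmono : MonoPreserving γ) (θ : Ω₀) (L : Set ι) (V : Finset ι)
    {f : (ι → Ω₀) → ℝ} (hf : Measurable f) (hm : Monotone f) :
    Monotone fun ω => ∫ x, f x ∂(gsApp γ θ L V ω) := by
  intro a b hab
  refine hmono (gsVol V L) f hf hm (fun x => ?_)
  simp only [gs_bc_apply]
  split_ifs
  · exact hab x
  · exact le_rfl

theorem gs_app_anti {ι Ω₀ : Type*} [Countable ι] [Finite Ω₀] [MeasurableSpace Ω₀]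
    [DiscreteMeasurableSpace Ω₀] [Nonempty Ω₀] [PartialOrder Ω₀] (γ : Specification ι Ω₀)
    (hmono : MonoPreserving γ) (θ : Ω₀) (hθ : ∀ a, a ≤ θ) (L : Set ι) (ω : ι → Ω₀)
    {f : (ι → Ω₀) → ℝ} (hf : IsLocal f) (hm : Monotone f) :
    Antitone fun V => ∫ x, f x ∂(gsApp γ θ L V ω) := by
  intro V V' hV
  have hfm := gs_local_measurable hf
  obtain ⟨C, hC⟩ := gs_local_bdd hf
  have hsub : gsVol V L ⊆ gsVol V' L := fun x hx => by
    rw [gs_mem_vol] at hx ⊢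
    exact ⟨hV hx.1, hx.2⟩
  have hp := γ.isProb (gsVol V' L) (gsBc θ V' L ω)
  have hp' := γ.isProb (gsVol V L)
  simp only [gsApp]
  rw [gs_spec_consistent γ hsub _ hfm hC]
  calc ∫ x, ∫ z, f z ∂(γ.k (gsVol V L) x) ∂(γ.k (gsVol V' L) (gsBc θ V' L ω))
      ≤ ∫ x, (∫ z, f z ∂(γ.k (gsVol V L) (gsBc θ V L ω)))
          ∂(γ.k (gsVol V' L) (gsBc θ V' L ω)) := by
        refine integral_mono_ae ?_ (integrable_const _) ?_
        · exact gs_integrable _ (gs_measurable_integral (gs_spec_meas γ _) (γ.isProb _) hfm)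
            (C := C) fun ω => gs_integral_abs_le hC
        · filter_upwards [gs_spec_ae γ (gsVol V' L) (gsBc θ V' L ω)] with x hx
          refine hmono (gsVol V L) f hfm hm (fun y => ?_)
          rw [gs_bc_apply]
          split_ifs with hy
          · rw [hx y (by rw [gs_mem_vol]; exact fun h => hy.2 h.2), gs_bc_apply,
              if_pos ⟨hV hy.1, hy.2⟩]
          · exact hθ _
    _ = _ := by simp

theorem gs_app_tendsto {ι Ω₀ : Type*} [Countable ι] [Finite Ω₀] [MeasurableSpace Ω₀]
    [DiscreteMeasurableSpace Ω₀] [Nonempty Ω₀] [PartialOrder Ω₀] (γ : Specification ι Ω₀)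
    (hmono : MonoPreserving γ) (θ : Ω₀) (hθ : ∀ a, a ≤ θ) (L : Set ι) (ω : ι → Ω₀)
    {f : (ι → Ω₀) → ℝ} (hf : IsLocal f) :
    ∃ c, Tendsto (fun V => ∫ x, f x ∂(gsApp γ θ L V ω)) atTop (𝓝 c) := by
  have hp := gs_app_prob γ θ L
  have key : ∀ f : (ι → Ω₀) → ℝ, IsLocal f → Monotone f →
      ∃ c, Tendsto (fun V => ∫ x, f x ∂(gsApp γ θ L V ω)) atTop (𝓝 c) := by
    intro f hf hm
    obtain ⟨C, hC⟩ := gs_local_bdd hf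
    refine ⟨_, tendsto_atTop_ciInf (gs_app_anti γ hmono θ hθ L ω hf hm) ⟨-C, ?_⟩⟩
    rintro _ ⟨V, rfl⟩
    exact (abs_le.1 (gs_integral_abs_le hC)).1
  obtain ⟨f₁, f₂, h1, m1, h2, m2, rfl⟩ := gs_local_decomp hf
  obtain ⟨c₁, hc₁⟩ := key f₁ h1 m1
  obtain ⟨c₂, hc₂⟩ := key f₂ h2 m2
  refine ⟨c₁ - c₂, (hc₁.sub hc₂).congr fun V => ?_⟩
  rw [integral_sub (gs_local_integrable h1 _) (gs_local_integrable h2 _)]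

theorem gs_app_comp {ι Ω₀ : Type*} [Countable ι] [Finite Ω₀] [MeasurableSpace Ω₀]
    [DiscreteMeasurableSpace Ω₀] [Nonempty Ω₀] (γ : Specification ι Ω₀)
    (θ : Ω₀) {L L' : Set ι} (hL : L ⊆ L') (V : Finset ι) (ω : ι → Ω₀)
    {f : (ι → Ω₀) → ℝ} (hf : IsLocal f) :
    ∫ x, ∫ z, f z ∂(gsApp γ θ L V x) ∂(gsApp γ θ L' V ω) = ∫ x, f x ∂(gsApp γ θ L' V ω) := by
  have hfm := gs_local_measurable hf
  obtain ⟨C, hC⟩ := gs_local_bdd hf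
  have hsub : gsVol V L ⊆ gsVol V L' := fun x hx => by
    rw [gs_mem_vol] at hx ⊢
    exact ⟨hx.1, hL hx.2⟩
  simp only [gsApp]
  rw [gs_spec_consistent γ hsub _ hfm hC]
  refine integral_congr_ae ?_
  filter_upwards [gs_spec_ae γ (gsVol V L') (gsBc θ V L' ω)] with x hx
  have : γ.k (gsVol V L) (gsBc θ V L x) = γ.k (gsVol V L) x := by
    refine gs_spec_congr γ _ fun y hy => ?_
    rw [gs_bc_apply]
    split_ifs with h
    · rfl
    · rw [gs_mem_vol] at hy
      have hyV : y ∉ V := fun hV => by tauto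
      rw [hx y (by rw [gs_mem_vol]; tauto), gs_bc_apply, if_neg (by tauto)]
  simp only [this]

/-- Existence of the global specification in the direction of the maximal element `θ`. -/
theorem gs_exists {ι Ω₀ : Type*} [Countable ι] [Finite Ω₀] [MeasurableSpace Ω₀]
    [DiscreteMeasurableSpace Ω₀] [PartialOrder Ω₀] (γ : Specification ι Ω₀)
    (hmono : MonoPreserving γ) (θ : Ω₀) (hθ : ∀ a, a ≤ θ) :
    ∃ G : GlobalSpecification ι Ω₀,
      (∀ L ω f, IsLocal f →
        Tendsto (fun V => ∫ x, f x ∂(gsApp γ θ L V ω)) atTop (𝓝 (∫ x, f x ∂(G.k L ω)))) ∧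
      (∀ L f, IsLocal f → QuasilocalInDir (fun _ => θ) fun ω => ∫ x, f x ∂(G.k L ω)) := by
  have hne : Nonempty Ω₀ := ⟨θ⟩
  have hex : ∀ (L : Set ι) (ω : ι → Ω₀), ∃ μ : Measure (ι → Ω₀), IsProbabilityMeasure μ ∧
      ∀ f, IsLocal f →
        Tendsto (fun V => ∫ x, f x ∂(gsApp γ θ L V ω)) atTop (𝓝 (∫ x, f x ∂μ)) := fun L ω =>
    gs_exists_limit atTop _ (fun V => gs_app_prob γ θ L V ω)
      fun f hf => gs_app_tendsto γ hmono θ hθ L ω hf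
  choose k hk hlim using hex
  have happ := gs_app_prob γ θ
  have hle : ∀ L ω f, IsLocal f → Monotone f → ∀ V,
      ∫ x, f x ∂(k L ω) ≤ ∫ x, f x ∂(gsApp γ θ L V ω) := fun L ω f hf hm V =>
    (gs_app_anti γ hmono θ hθ L ω hf hm).le_of_tendsto (hlim L ω f hf) V
  -- measurability
  have hmeas' : ∀ L, Measurable[cylinderSigma Ω₀ Lᶜ] (k L) := by
    intro L
    refine @Measurable.measure_of_isPiSystem_of_isProbabilityMeasure _ _ (cylinderSigma Ω₀ Lᶜ) _
      (k L) (hk L) _ generateFrom_measurableCylinders.symm isPiSystem_measurableCylinders ?_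
    intro A hA
    have hAm : MeasurableSet A := .of_mem_measurableCylinders hA
    have hloc := gs_indicator_local hA
    have h1 : Measurable[cylinderSigma Ω₀ Lᶜ]
        fun ω => ∫ x, A.indicator (fun _ => (1 : ℝ)) x ∂(k L ω) := by
      refine @measurable_of_tendsto_metrizable' _ _ (cylinderSigma Ω₀ Lᶜ) _ _ _ _ _
        (fun V ω => ∫ x, A.indicator (fun _ => (1 : ℝ)) x ∂(gsApp γ θ L V ω)) _ atTop _ _ ?_ ?_
      · intro V
        refine gs_cyl_measurable (V.filter (· ∉ L)) (fun x hx => ?_) fun ω ω' h => ?_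
        · simpa using (Finset.mem_filter.1 hx).2
        · simp only [gs_app_dep γ θ L V fun x hx hxL => h x (Finset.mem_filter.2 ⟨hx, hxL⟩)]
      · rw [tendsto_pi_nhds]
        exact fun ω => hlim L ω _ hloc
    have h2 : (fun ω => k L ω A) =
        fun ω => ENNReal.ofReal (∫ x, A.indicator (fun _ => (1 : ℝ)) x ∂(k L ω)) := by
      funext ω
      rw [integral_indicator_const _ hAm]
      simp
    rw [h2]
    exact ENNReal.measurable_ofReal.comp h1
  have hmeas : ∀ L, Measurable (k L) := fun L => (hmeas' L).mono (gs_cyl_le _) le_rfl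
  -- properness
  have hae : ∀ L ω, ∀ᵐ x ∂(k L ω), ∀ y, y ∉ L → x y = ω y := by
    intro L ω
    rw [ae_all_iff]
    intro y
    by_cases hy : y ∈ L
    · exact Eventually.of_forall fun x h => absurd hy h
    let A : Set (ι → Ω₀) := {x | x y = ω y}
    have hloc : IsLocal (A.indicator fun _ => (1 : ℝ)) := by
      refine gs_isLocal_of {y} fun a b hab => ?_
      have := hab y (by simp)
      simp [Set.indicator, A, this]
    have hAm : MeasurableSet A :=
      measurableSet_eq_fun (f := fun x : ι → Ω₀ => x y) (measurable_pi_apply y) measurable_const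
    have h1 := hlim L ω _ hloc
    have h2 : ∀ᶠ V in atTop, ∫ x, A.indicator (fun _ => (1 : ℝ)) x ∂(gsApp γ θ L V ω) = 1 := by
      filter_upwards [eventually_ge_atTop ({y} : Finset ι)] with V hV
      have hyV : y ∈ V := hV (Finset.mem_singleton_self y)
      have : ∀ᵐ x ∂(gsApp γ θ L V ω), A.indicator (fun _ => (1 : ℝ)) x = 1 := by
        filter_upwards [gs_spec_ae γ (gsVol V L) (gsBc θ V L ω)] with x hx
        have := hx y (by rw [gs_mem_vol]; tauto)
        rw [gs_bc_apply, if_pos ⟨hyV, hy⟩] at this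
        exact Set.indicator_of_mem (s := A) this _
      rw [integral_congr_ae this]
      simp
    have h3 : ∫ x, A.indicator (fun _ => (1 : ℝ)) x ∂(k L ω) = 1 :=
      tendsto_nhds_unique (h1.congr' h2) tendsto_const_nhds
    rw [integral_indicator_const _ hAm] at h3
    have h4 : k L ω A = 1 := by
      have : (k L ω A).toReal = 1 := by simpa [Measure.real] using h3
      exact (ENNReal.toReal_eq_one_iff _).1 this
    filter_upwards [(mem_ae_iff_prob_eq_one hAm).2 h4] with x hx _
    exact hx
  have hproper : ∀ (L : Set ι) (B : Set (ι → Ω₀)),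
      MeasurableSet[cylinderSigma Ω₀ Lᶜ] B → ∀ ω, k L ω B = B.indicator 1 ω := by
    intro L B hB ω
    by_cases hω : ω ∈ B
    · rw [Set.indicator_of_mem hω, Pi.one_apply]
      refine (mem_ae_iff_prob_eq_one (gs_cyl_le _ _ hB)).1 ?_
      filter_upwards [hae L ω] with x hx
      exact (gs_cyl_mem_congr hB fun y hy => hx y hy).2 hω
    · rw [Set.indicator_of_notMem hω]
      rw [measure_eq_zero_iff_ae_notMem]
      filter_upwards [hae L ω] with x hx hxB
      exact hω ((gs_cyl_mem_congr hB fun y hy => hx y hy).1 hxB)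
  -- consistency
  have hcons : ∀ ⦃L L' : Set ι⦄, L ⊆ L' → ∀ ω, (k L' ω).bind (k L) = k L' ω := by
    intro L L' hL ω
    have hpb : IsProbabilityMeasure ((k L' ω).bind (k L)) := ⟨by
      rw [Measure.bind_apply MeasurableSet.univ (hmeas L).aemeasurable]
      simp⟩
    refine gs_ext_mono fun f hf hm => ?_
    have hfm := gs_local_measurable hf
    obtain ⟨C, hC⟩ := gs_local_bdd hf
    rw [gs_integral_bind (hmeas L) (hk L) hfm hC]
    have gloc : ∀ V, IsLocal fun x => ∫ z, f z ∂(gsApp γ θ L V x) := fun V =>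
      gs_app_local γ θ L V f
    have gmono : ∀ V, Monotone fun x => ∫ z, f z ∂(gsApp γ θ L V x) := fun V =>
      gs_app_mono γ hmono θ L V hfm hm
    have kint : Integrable (fun x => ∫ z, f z ∂(k L x)) (k L' ω) :=
      gs_integrable _ (gs_measurable_integral (hmeas L) (hk L) hfm)
        (C := C) fun ω => gs_integral_abs_le hC
    apply le_antisymm
    · refine ge_of_tendsto' (hlim L' ω f hf) fun V => ?_
      calc ∫ x, ∫ z, f z ∂(k L x) ∂(k L' ω)
          ≤ ∫ x, ∫ z, f z ∂(gsApp γ θ L V x) ∂(k L' ω) :=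
            integral_mono kint (gs_local_integrable (gloc V) _) fun x => hle L x f hf hm V
        _ ≤ ∫ x, ∫ z, f z ∂(gsApp γ θ L V x) ∂(gsApp γ θ L' V ω) :=
            hle L' ω _ (gloc V) (gmono V) V
        _ = _ := gs_app_comp γ θ hL V ω hf
    · have hdct : Tendsto (fun V => ∫ x, ∫ z, f z ∂(gsApp γ θ L V x) ∂(k L' ω)) atTop
          (𝓝 (∫ x, ∫ z, f z ∂(k L x) ∂(k L' ω))) := by
        refine tendsto_integral_filter_of_dominated_convergence (fun _ => C) ?_ ?_
          (integrable_const _) ?_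
        · exact Eventually.of_forall fun V =>
            (gs_local_measurable (gloc V)).aestronglyMeasurable
        · exact Eventually.of_forall fun V => Eventually.of_forall fun x => by
            rw [Real.norm_eq_abs]
            exact gs_integral_abs_le hC
        · exact Eventually.of_forall fun x => hlim L x f hf
      refine ge_of_tendsto' hdct fun V => ?_
      refine le_of_tendsto_of_tendsto (hlim L' ω f hf) (hlim L' ω _ (gloc V)) ?_
      filter_upwards [eventually_ge_atTop V] with W hW
      rw [← gs_app_comp γ θ hL W ω hf]
      refine integral_mono (gs_local_integrable (gloc W) _) (gs_local_integrable (gloc V) _) ?_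
      exact fun x => gs_app_anti γ hmono θ hθ L x hf hm hW
  -- directional continuity
  have hcont : ∀ L f, IsLocal f → QuasilocalInDir (fun _ => θ) fun ω => ∫ x, f x ∂(k L ω) := by
    have key : ∀ L f, IsLocal f → Monotone f →
        QuasilocalInDir (fun _ => θ) fun ω => ∫ x, f x ∂(k L ω) := by
      intro L f hf hm ω
      have hfm := gs_local_measurable hf
      refine tendsto_of_tendsto_of_tendsto_of_le_of_le (tendsto_const_nhds) (hlim L ω f hf) ?_ ?_
      · intro S
        refine le_of_tendsto_of_tendsto' (hlim L ω f hf) (hlim L _ f hf) fun V => ?_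
        refine gs_app_mono γ hmono θ L V hfm hm fun x => ?_
        rw [gs_splice_apply]
        split_ifs
        · exact le_rfl
        · exact hθ _
      · intro S
        refine (hle L _ f hf hm S).trans_eq ?_
        simp only
        rw [gs_app_dep γ θ L S (ω' := ω) fun x hx _ => by
          rw [gs_splice_apply, if_pos (by simpa using hx)]]
    intro L f hf
    obtain ⟨f₁, f₂, h1, m1, h2, m2, rfl⟩ := gs_local_decomp hf
    intro ω
    have h := (key L f₁ h1 m1 ω).sub (key L f₂ h2 m2 ω)
    simp only at h ⊢
    rw [integral_sub (gs_local_integrable h1 _) (gs_local_integrable h2 _)]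
    refine h.congr fun S => ?_
    rw [integral_sub (gs_local_integrable h1 _) (gs_local_integrable h2 _)]
  exact ⟨⟨k, hk, fun L A hA => (Measure.measurable_coe hA).comp (hmeas' L), hproper, hcons⟩,
    hlim, hcont⟩

theorem gs_univ {ι Ω₀ : Type*} [Finite Ω₀] [MeasurableSpace Ω₀]
    [DiscreteMeasurableSpace Ω₀] (γ : Specification ι Ω₀) (θ : Ω₀)
    (G : GlobalSpecification ι Ω₀)
    (hG : ∀ L ω f, IsLocal f →
        Tendsto (fun V => ∫ x, f x ∂(gsApp γ θ L V ω)) atTop (𝓝 (∫ x, f x ∂(G.k L ω))))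
    (μ : Measure (ι → Ω₀)) (hμ : IsLimitWithBoundary γ (fun _ => θ) μ) (ω : ι → Ω₀) :
    G.k Set.univ ω = μ := by
  have hne : Nonempty Ω₀ := ⟨θ⟩
  have := hμ.1
  have := G.isProb Set.univ ω
  refine gs_ext fun f hf => ?_
  refine tendsto_nhds_unique (hG Set.univ ω f hf) ((hμ.2 f hf).congr fun V => ?_)
  have h1 : gsVol V (Set.univ : Set ι) = V := by ext x; simp [gs_mem_vol]
  have h2 : gsBc θ V (Set.univ : Set ι) ω = fun _ => θ := by
    funext x; simp [gs_bc_apply]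
  simp only [specInt, gsApp, h1, h2]

theorem gs_condexp {ι Ω₀ : Type*} [MeasurableSpace Ω₀]
    (G : GlobalSpecification ι Ω₀) (μ : Measure (ι → Ω₀)) [IsProbabilityMeasure μ]
    (ω₀ : ι → Ω₀) (hμ : G.k Set.univ ω₀ = μ) (D : Set ι) (f : (ι → Ω₀) → ℝ)
    (hf : Measurable f) (hb : ∃ C : ℝ, ∀ ω, |f ω| ≤ C) (A : Set (ι → Ω₀))
    (hA : MeasurableSet[cylinderSigma Ω₀ D] A) :
    ∫ ω in A, (∫ x, f x ∂(G.k Dᶜ ω)) ∂μ = ∫ ω in A, f ω ∂μ := by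
  obtain ⟨C, hC⟩ := hb
  have hAm : MeasurableSet A := gs_cyl_le _ _ hA
  have hmeas : Measurable (G.k Dᶜ) :=
    Measure.measurable_of_measurable_coe _ fun A hA =>
      (G.meas Dᶜ A hA).mono (gs_cyl_le _) le_rfl
  have hbind : μ.bind (G.k Dᶜ) = μ := by
    rw [← hμ]; exact G.consistent (Set.subset_univ _) ω₀
  have hC' : ∀ ω, |A.indicator f ω| ≤ C := fun ω => by
    by_cases h : ω ∈ A
    · simpa [h] using hC ω
    · simpa [h] using (abs_nonneg _).trans (hC ω)
  rw [← integral_indicator hAm, ← integral_indicator hAm]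
  conv_rhs => rw [← hbind]
  rw [gs_integral_bind hmeas (G.isProb _) (hf.indicator hAm) hC']
  congr 1
  funext ω
  have := G.isProb Dᶜ ω
  have hpr := G.proper Dᶜ A (by rwa [compl_compl]) ω
  by_cases h : ω ∈ A
  · rw [Set.indicator_of_mem h] at hpr ⊢
    refine integral_congr_ae ?_
    filter_upwards [(mem_ae_iff_prob_eq_one hAm).2 hpr] with x hx
    rw [Set.indicator_of_mem hx]
  · rw [Set.indicator_of_notMem h] at hpr ⊢
    rw [measure_eq_zero_iff_ae_notMem] at hpr
    rw [integral_eq_zero_of_ae]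
    filter_upwards [hpr] with x hx
    rw [Set.indicator_of_notMem hx]; rfl

theorem gs_monotone {ι Ω₀ : Type*} [Countable ι] [Finite Ω₀] [MeasurableSpace Ω₀]
    [DiscreteMeasurableSpace Ω₀] [PartialOrder Ω₀] [BoundedOrder Ω₀]
    (γ : Specification ι Ω₀) (hmono : MonoPreserving γ) (θ : Ω₀)
    (G : GlobalSpecification ι Ω₀)
    (hG : ∀ L ω f, IsLocal f →
        Tendsto (fun V => ∫ x, f x ∂(gsApp γ θ L V ω)) atTop (𝓝 (∫ x, f x ∂(G.k L ω))))
    (L : Set ι) (f : (ι → Ω₀) → ℝ) (hf : Measurable f) (hm : Monotone f) :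
    Monotone fun ω => ∫ x, f x ∂(G.k L ω) := by
  intro a b hab
  have := G.isProb L a
  have := G.isProb L b
  refine gs_dom (fun g hg hgm => ?_) hf hm
  exact le_of_tendsto_of_tendsto' (hG L a g hg) (hG L b g hg) fun V =>
    gs_app_mono γ hmono θ L V (gs_local_measurable hg) hgm hab

theorem gs_compare {ι Ω₀ : Type*} [Countable ι] [Finite Ω₀] [MeasurableSpace Ω₀]
    [DiscreteMeasurableSpace Ω₀] [PartialOrder Ω₀] [BoundedOrder Ω₀]
    (γ : Specification ι Ω₀) (hmono : MonoPreserving γ) (θ θ' : Ω₀) (hθ : θ ≤ θ')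
    (G G' : GlobalSpecification ι Ω₀)
    (hG : ∀ L ω f, IsLocal f →
        Tendsto (fun V => ∫ x, f x ∂(gsApp γ θ L V ω)) atTop (𝓝 (∫ x, f x ∂(G.k L ω))))
    (hG' : ∀ L ω f, IsLocal f →
        Tendsto (fun V => ∫ x, f x ∂(gsApp γ θ' L V ω)) atTop (𝓝 (∫ x, f x ∂(G'.k L ω))))
    (L : Set ι) (f : (ι → Ω₀) → ℝ) (hf : Measurable f) (hm : Monotone f) (ω : ι → Ω₀) :
    ∫ x, f x ∂(G.k L ω) ≤ ∫ x, f x ∂(G'.k L ω) := by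
  have := G.isProb L ω
  have := G'.isProb L ω
  refine gs_dom (fun g hg hgm => ?_) hf hm
  refine le_of_tendsto_of_tendsto' (hG L ω g hg) (hG' L ω g hg) fun V => ?_
  refine hmono (gsVol V L) g (gs_local_measurable hg) hgm fun x => ?_
  simp only [gs_bc_apply]
  split_ifs
  · exact le_rfl
  · exact hθ

/-- Existence of the global specification in the direction of the minimal element. -/
theorem gs_exists_dual {ι Ω₀ : Type*} [Countable ι] [Finite Ω₀] [MeasurableSpace Ω₀]
    [DiscreteMeasurableSpace Ω₀] [inst : PartialOrder Ω₀] (γ : Specification ι Ω₀)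
    (hmono : MonoPreserving γ) (θ : Ω₀) (hθ : ∀ a, θ ≤ a) :
    ∃ G : GlobalSpecification ι Ω₀,
      (∀ L ω f, IsLocal f →
        Tendsto (fun V => ∫ x, f x ∂(gsApp γ θ L V ω)) atTop (𝓝 (∫ x, f x ∂(G.k L ω)))) ∧
      (∀ L f, IsLocal f → QuasilocalInDir (fun _ => θ) fun ω => ∫ x, f x ∂(G.k L ω)) := by
  let dual : PartialOrder Ω₀ := (inferInstance : PartialOrder Ω₀ᵒᵈ)
  refine @gs_exists ι Ω₀ _ _ _ _ dual γ ?_ θ (fun a => hθ a)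
  intro Λ f hf hm a b hab
  have hm' : @Monotone (ι → Ω₀) ℝ
      (@Pi.preorder ι (fun _ => Ω₀) fun _ => inst.toPreorder) _ (fun ω => - f ω) := fun a b hab => neg_le_neg (hm hab)
  have h := hmono Λ (fun ω => - f ω) hf.neg hm' (a := b) (b := a) hab
  simp only [specInt, integral_neg, neg_le_neg_iff] at h
  exact h

/-- The conditional expectations `μ±(f|ℱ_D)` of the extremal states of a
monotonicity-preserving specification admit everywhere-defined monotonicity-preserving
right (resp. left) continuous versions coming from global specifications, and
`μ⁻(f|ℱ_D) ≤ μ⁺(f|ℱ_D)` pointwise for increasing `f`. -/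
theorem global_specifications_for_extremal_states
    {Ω₀ : Type*} [Fintype Ω₀] [MeasurableSpace Ω₀] [DiscreteMeasurableSpace Ω₀]
    [LinearOrder Ω₀] [BoundedOrder Ω₀] {d : ℕ}
    (γ : Specification (Site d) Ω₀) (hmono : MonoPreserving γ)
    (μp μm : Measure (Site d → Ω₀))
    (hμp : IsLimitWithBoundary γ (fun _ => (⊤ : Ω₀)) μp)
    (hμm : IsLimitWithBoundary γ (fun _ => (⊥ : Ω₀)) μm) :
    ∃ Gp Gm : GlobalSpecification (Site d) Ω₀,
      (∀ (Λ : Set (Site d)) (f : (Site d → Ω₀) → ℝ), Measurable f → Monotone f →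
        Monotone fun ω => ∫ x, f x ∂(Gp.k Λ ω)) ∧
      (∀ (Λ : Set (Site d)) (f : (Site d → Ω₀) → ℝ), Measurable f → Monotone f →
        Monotone fun ω => ∫ x, f x ∂(Gm.k Λ ω)) ∧
      (∀ (Λ : Set (Site d)) (f : (Site d → Ω₀) → ℝ), IsLocal f →
        QuasilocalInDir (fun _ => (⊤ : Ω₀)) fun ω => ∫ x, f x ∂(Gp.k Λ ω)) ∧
      (∀ (Λ : Set (Site d)) (f : (Site d → Ω₀) → ℝ), IsLocal f →
        QuasilocalInDir (fun _ => (⊥ : Ω₀)) fun ω => ∫ x, f x ∂(Gm.k Λ ω)) ∧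
      (∀ (D : Set (Site d)) (f : (Site d → Ω₀) → ℝ), Measurable f →
        (∃ C : ℝ, ∀ ω, |f ω| ≤ C) →
        ∀ A : Set (Site d → Ω₀), MeasurableSet[cylinderSigma Ω₀ D] A →
          ∫ ω in A, (∫ x, f x ∂(Gp.k Dᶜ ω)) ∂μp = ∫ ω in A, f ω ∂μp) ∧
      (∀ (D : Set (Site d)) (f : (Site d → Ω₀) → ℝ), Measurable f →
        (∃ C : ℝ, ∀ ω, |f ω| ≤ C) →
        ∀ A : Set (Site d → Ω₀), MeasurableSet[cylinderSigma Ω₀ D] A →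
          ∫ ω in A, (∫ x, f x ∂(Gm.k Dᶜ ω)) ∂μm = ∫ ω in A, f ω ∂μm) ∧
      (∀ (D : Set (Site d)) (f : (Site d → Ω₀) → ℝ), Measurable f → Monotone f →
        ∀ ω, (∫ x, f x ∂(Gm.k Dᶜ ω)) ≤ ∫ x, f x ∂(Gp.k Dᶜ ω)) := by
  have hp := hμp.1
  have hm := hμm.1
  obtain ⟨Gp, hGp, hcp⟩ := gs_exists γ hmono (⊤ : Ω₀) fun a => le_top
  obtain ⟨Gm, hGm, hcm⟩ := gs_exists_dual γ hmono (⊥ : Ω₀) fun a => bot_le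
  refine ⟨Gp, Gm, gs_monotone γ hmono ⊤ Gp hGp, gs_monotone γ hmono ⊥ Gm hGm, hcp, hcm,
    ?_, ?_, ?_⟩
  · exact gs_condexp Gp μp (fun _ => ⊤) (gs_univ γ ⊤ Gp hGp μp hμp _)
  · exact gs_condexp Gm μm (fun _ => ⊥) (gs_univ γ ⊥ Gm hGm μm hμm _)
  · intro D f hf hfm ω
    exact gs_compare γ hmono ⊥ ⊤ bot_le Gm Gp hGm hGp Dᶜ f hf hfm ω

end
end

section
/- Let γ be a translation-invariant monotonicity-preserving specification with associated specifications γ^(±)_Λ(·|ω) = lim_{S↑𝕃} γ_Λ(·|ω_S ±_{Sᶜ}) and extremal measure μ⁺ = lim_{Λ↑𝕃} γ_Λ(·|+). Let μ be a probability measure with μ_{Λ_M∖Λ} ≪ μ⁺_{Λ_M∖Λ} and density g_{Λ_M∖Λ} = dμ_{Λ_M∖Λ}/dμ⁺_{Λ_M∖Λ}, where Λ ⊂ Λ_M are finite. Then for every increasing local f: 0 ≤ μ⁺[ g_{Λ_M∖Λ} (γ^{M,+}_Λ(f) − γ_Λ(f)) ] ≤ μ( γ^{M,+}_Λ(f) −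 γ^{M,−}_Λ(f) ), where γ^{M,±}_Λ(f)(ω) = γ_Λ(f | ω_{Λ_M} ±_{𝕃∖Λ_M}). -/
open MeasureTheory Filter Topology
open scoped ENNReal MeasureTheory Classical

noncomputable section

theorem specInt_congr_off {ι Ω₀ : Type*} [MeasurableSpace Ω₀] (γ : Specification ι Ω₀)
    (Λ : Finset ι) (f : (ι → Ω₀) → ℝ) (ω ω' : ι → Ω₀) (h : ∀ x, x ∉ Λ → ω x = ω' x) :
    specInt γ Λ f ω = specInt γ Λ f ω' := by
  have : γ.k Λ ω = γ.k Λ ω' := by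
    ext A hA
    obtain ⟨B, hB, hB'⟩ := γ.meas Λ A hA (measurableSet_singleton (γ.k Λ ω' A))
    have e : (fun (x : (((Λ : Set ι))ᶜ : Set ι)) => ω (x : ι)) =
        fun (x : (((Λ : Set ι))ᶜ : Set ι)) => ω' (x : ι) := by
      funext x
      exact h x (fun hx => x.2 (Finset.mem_coe.2 hx))
    have h1 : ω' ∈ (fun ω => γ.k Λ ω A) ⁻¹' {γ.k Λ ω' A} := rfl
    rw [← hB', Set.mem_preimage, ← e] at h1
    have h2 : ω ∈ (fun ω => γ.k Λ ω A) ⁻¹' {γ.k Λ ω' A} := by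
      rw [← hB']
      exact h1
    exact h2
  unfold specInt
  rw [this]

/-- Key estimate in the proof of Corollary r.cor1(b): for increasing local `f` and a
measure `μ` with density `g_{Λ_M∖Λ}` with respect to `μ⁺`,
`0 ≤ μ⁺[g_{Λ_M∖Λ}(γ^{M,+}_Λ f − γ_Λ f)] ≤ μ(γ^{M,+}_Λ f − γ^{M,−}_Λ f)`. -/
theorem plus_minus_boundary_density_estimate
    {Ω₀ : Type*} [Fintype Ω₀] [MeasurableSpace Ω₀] [DiscreteMeasurableSpace Ω₀]
    [LinearOrder Ω₀] [BoundedOrder Ω₀] {d : ℕ}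
    (γ : Specification (Site d) Ω₀) (hTI : TransInvSpec γ) (hmono : MonoPreserving γ)
    (γp γm : Specification (Site d) Ω₀)
    (hγp : IsDirLimitSpec γ γp (fun _ => (⊤ : Ω₀)))
    (hγm : IsDirLimitSpec γ γm (fun _ => (⊥ : Ω₀)))
    (μp : Measure (Site d → Ω₀))
    (hμp : IsLimitWithBoundary γ (fun _ => (⊤ : Ω₀)) μp)
    (μ : Measure (Site d → Ω₀)) (hμ : IsProbabilityMeasure μ)
    (Λ : Finset (Site d)) (M : ℕ) (hΛ : Λ ⊆ cube d M)
    (hac : restrictTo (cube d M \ Λ) μ ≪ restrictTo (cube d M \ Λ) μp)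
    (f : (Site d → Ω₀) → ℝ) (hf : IsLocal f) (hfmono : Monotone f) :
    0 ≤ ∫ ω, density (cube d M \ Λ) μ μp ω *
          (specInt γ Λ f (splice ((cube d M : Finset (Site d)) : Set (Site d)) ω
              (fun _ => (⊤ : Ω₀)))
            - specInt γ Λ f ω) ∂μp ∧
      (∫ ω, density (cube d M \ Λ) μ μp ω *
          (specInt γ Λ f (splice ((cube d M : Finset (Site d)) : Set (Site d)) ω
              (fun _ => (⊤ : Ω₀)))
            - specInt γ Λ f ω) ∂μp)
        ≤ ∫ ω, (specInt γ Λ f (splice ((cube d M : Finset (Site d)) : Set (Site d)) ω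
              (fun _ => (⊤ : Ω₀)))
            - specInt γ Λ f (splice ((cube d M : Finset (Site d)) : Set (Site d)) ω
              (fun _ => (⊥ : Ω₀)))) ∂μ := by
  classical
  have hfm : Measurable f := by
    obtain ⟨Δ, hΔ⟩ := hf
    refine hΔ.mono ?_ le_rfl
    exact Measurable.comap_le (measurable_pi_lambda _ fun x => measurable_pi_apply _)
  have hm := hmono Λ f hfm hfmono
  haveI := hμp.1
  set C : Set (Site d) := ((cube d M : Finset (Site d)) : Set (Site d)) with hC
  have hup : ∀ ω, specInt γ Λ f ω ≤ specInt γ Λ f (splice C ω (fun _ => (⊤ : Ω₀))) := by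
    intro ω
    apply hm
    intro x
    unfold splice
    split_ifs
    · exact le_rfl
    · exact le_top
  have hlo : ∀ ω, specInt γ Λ f (splice C ω (fun _ => (⊥ : Ω₀))) ≤ specInt γ Λ f ω := by
    intro ω
    apply hm
    intro x
    unfold splice
    split_ifs
    · exact le_rfl
    · exact bot_le
  have hnn : ∀ ω, 0 ≤ density (cube d M \ Λ) μ μp ω *
      (specInt γ Λ f (splice C ω (fun _ => (⊤ : Ω₀))) - specInt γ Λ f ω) := fun ω =>
    mul_nonneg ENNReal.toReal_nonneg (sub_nonneg.2 (hup ω))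
  refine ⟨integral_nonneg hnn, ?_⟩
  let R : (Site d → Ω₀) → ({x // x ∈ cube d M \ Λ} → Ω₀) := fun ω x => ω (x : Site d)
  have hR : Measurable R := measurable_pi_lambda _ fun x => measurable_pi_apply _
  let E : ({x // x ∈ cube d M \ Λ} → Ω₀) → (Site d → Ω₀) := fun η x =>
    if h : x ∈ cube d M \ Λ then η ⟨x, h⟩ else ⊤
  let H : ({x // x ∈ cube d M \ Λ} → Ω₀) → ℝ := fun η =>
    specInt γ Λ f (splice C (E η) (fun _ => (⊤ : Ω₀)))
      - specInt γ Λ f (splice C (E η) (fun _ => (⊥ : Ω₀)))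
  have hH : ∀ ω, specInt γ Λ f (splice C ω (fun _ => (⊤ : Ω₀)))
      - specInt γ Λ f (splice C ω (fun _ => (⊥ : Ω₀))) = H (R ω) := by
    intro ω
    have key : ∀ θ : Site d → Ω₀, specInt γ Λ f (splice C ω θ)
        = specInt γ Λ f (splice C (E (R ω)) θ) := by
      intro θ
      apply specInt_congr_off
      intro x hx
      by_cases hxC : x ∈ C
      · have hx' : x ∈ cube d M \ Λ := Finset.mem_sdiff.2 ⟨by simpa [hC] using hxC, hx⟩
        simp only [splice, if_pos hxC, E, R, dif_pos hx']
      · simp only [splice, if_neg hxC]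
    rw [key, key]
  haveI : IsProbabilityMeasure (restrictTo (cube d M \ Λ) μ) :=
    Measure.isProbabilityMeasure_map hR.aemeasurable
  haveI : IsProbabilityMeasure (restrictTo (cube d M \ Λ) μp) :=
    Measure.isProbabilityMeasure_map hR.aemeasurable
  have hHm : Measurable H := measurable_of_countable H
  have hint : Integrable H (restrictTo (cube d M \ Λ) μ) := Integrable.of_finite
  have hint2 : Integrable (fun η => ((restrictTo (cube d M \ Λ) μ).rnDeriv
      (restrictTo (cube d M \ Λ) μp) η).toReal * H η) (restrictTo (cube d M \ Λ) μp) :=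
    Integrable.of_finite
  have e1 : ∫ ω, density (cube d M \ Λ) μ μp ω * H (R ω) ∂μp = ∫ ω, H (R ω) ∂μ := by
    have a := integral_rnDeriv_smul (f := H) hac
    simp only [smul_eq_mul] at a
    rw [restrictTo, restrictTo] at a
    rw [integral_map hR.aemeasurable (measurable_of_countable _).aestronglyMeasurable,
      integral_map hR.aemeasurable hHm.aestronglyMeasurable] at a
    exact a
  simp_rw [hH]
  rw [← e1]
  refine integral_mono_of_nonneg (Eventually.of_forall hnn) (hint2.comp_measurable hR)
    (Eventually.of_forall fun ω => ?_)
  refine mul_le_mul_of_nonneg_left ?_ ENNReal.toReal_nonneg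
  rw [← hH]
  linarith [hlo ω]


end
end
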